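/- Let d ≥ 2, let B ⊂ ℝ^d be an open ball, and let Ω ⊂ ℝ^d be a nonempty bounded convex open set with B ⊆ Ω. Then μ₁(B) ≥ μ₁(Ω); that is, monotonicity of the first nonzero Neumann eigenvalue holds whenever the inner domain is a ball. -/

import Mathlib

open MeasureTheory Real Filter

noncomputable section

/-- Euclidean space `ℝ^d`. -/
abbrev Euc (d : ℕ) := EuclideanSpace ℝ (Fin d)

/-- The Rayleigh quotient of a function `u` on a set `Ω ⊆ ℝ^d`. -/
noncomputable def rayleigh {d : ℕ} (Ω : Set (Euc d)) (u : Euc d → ℝ) : ℝ :=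
  (∫ x in Ω, ‖fderiv ℝ u x‖ ^ 2) / (∫ x in Ω, (u x) ^ 2)

/-- The `k`-th Neumann eigenvalue of `Ω ⊆ ℝ^d`, defined by the variational (min-max)
principle: the infimum, over all subspaces `V` of smooth functions `ℝ^d → ℝ` whose space of
restrictions to `Ω` is `(k+1)`-dimensional, of the supremum of the Rayleigh quotient over
the elements of `V` that are nonzero in `L²(Ω)`. -/
noncomputable def neumannEigenvalue {d : ℕ} (k : ℕ) (Ω : Set (Euc d)) : ℝ :=
  sInf { t : ℝ | ∃ V : Submodule ℝ (Euc d → ℝ),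
    (∀ u ∈ V, ContDiff ℝ (⊤ : ℕ∞) u) ∧
    Module.finrank ℝ (V.map (LinearMap.funLeft ℝ ℝ ((↑) : Ω → Euc d))) = k + 1 ∧
    t = sSup { r : ℝ | ∃ u ∈ V, (0 < ∫ x in Ω, (u x) ^ 2) ∧ r = rayleigh Ω u } }

/-- A nonempty bounded convex open subset of `ℝ^d`. -/
def IsConvexDomain {d : ℕ} (Ω : Set (Euc d)) : Prop :=
  Ω.Nonempty ∧ IsOpen Ω ∧ Bornology.IsBounded Ω ∧ Convex ℝ Ω

/-- The optimal constant `α_{k,d}`: the infimum of `μ_k(Ω₁)/μ_k(Ω₂)` over all pairs of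
nonempty bounded convex open sets `Ω₁ ⊆ Ω₂ ⊂ ℝ^d`. -/
noncomputable def alphaConst (k d : ℕ) : ℝ :=
  sInf { r : ℝ | ∃ Ω₁ Ω₂ : Set (Euc d), IsConvexDomain Ω₁ ∧ IsConvexDomain Ω₂ ∧ Ω₁ ⊆ Ω₂ ∧
    r = neumannEigenvalue k Ω₁ / neumannEigenvalue k Ω₂ }

/-- The Bessel function of the first kind of order `ν` (for `x > 0`). -/
noncomputable def besselJ (ν : ℝ) (x : ℝ) : ℝ :=
  ∑' m : ℕ, ((-1 : ℝ) ^ m / (m.factorial * Real.Gamma (m + ν + 1))) * (x / 2) ^ (2 * (m : ℝ) + ν)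

/-- The first positive zero `j_{ν,1}` of the Bessel function `J_ν`. -/
noncomputable def besselZero1 (ν : ℝ) : ℝ :=
  sInf {x : ℝ | 0 < x ∧ besselJ ν x = 0}

/-- The second positive zero `j_{ν,2}` of the Bessel function `J_ν`. -/
noncomputable def besselZero2 (ν : ℝ) : ℝ :=
  sInf {x : ℝ | besselZero1 ν < x ∧ besselJ ν x = 0}

/-- coefficients of the profile power series -/
def pcoef (c : ℝ) : ℕ → ℝ
  | 0 => 1
  | (m+1) => - pcoef c m / (4 * (m + 1) * (c + m))

/-- confluent limit function of the profile -/
def pfun (c : ℝ) (s : ℝ) : ℝ := ∑' m : ℕ, pcoef c m * s ^ m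

lemma pcoef_bound (c : ℝ) (hc : 1 ≤ c) (m : ℕ) : |pcoef c m| ≤ 1 / m.factorial := by
  induction m with
  | zero => simp [pcoef]
  | succ m ih =>
    have h1 : (0:ℝ) < 4 * (m + 1) * (c + m) := by positivity
    rw [pcoef, abs_div, abs_neg, abs_of_pos h1, Nat.factorial_succ, div_le_div_iff₀ h1 (by positivity)]
    push_cast
    have h2 : |pcoef c m| * m.factorial ≤ 1 := by
      rwa [le_div_iff₀ (by positivity)] at ih
    have h3 : (1:ℝ) ≤ 4 * (c + m) := by
      have : (0:ℝ) ≤ m := by positivity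
      nlinarith
    nlinarith [mul_le_mul_of_nonneg_right h2 (by positivity : (0:ℝ) ≤ (m:ℝ)+1), (by positivity : (0:ℝ) ≤ (m:ℝ)+1)]

lemma pcoef_shift (c : ℝ) (hc : 1 ≤ c) (m : ℕ) :
    (m + 1) * pcoef c (m+1) = -(1 / (4 * c)) * pcoef (c+1) m := by
  induction m with
  | zero => simp [pcoef]; field_simp
  | succ m ih =>
    have h0 : c ≠ 0 := by positivity
    have h1 : (0:ℝ) < c + m := by positivity
    have h2 : (0:ℝ) < c + 1 + m := by positivity
    have h3 : (0:ℝ) < c + (m + 1) := by positivity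
    have e1 : pcoef c (m+1+1) = - pcoef c (m+1) / (4 * ((m+1:ℕ) + 1) * (c + (m+1 : ℕ))) := rfl
    have e2 : pcoef (c+1) (m+1) = - pcoef (c+1) m / (4 * (m + 1) * (c + 1 + m)) := rfl
    have e3 : pcoef c (m+1) = (-(1 / (4 * c)) * pcoef (c+1) m) / (m+1) := by
      rw [← ih]; field_simp
    rw [e1, e2, e3]; push_cast
    have : c + 1 + (m:ℝ) = c + (m + 1) := by ring
    rw [this]
    field_simp

lemma summable_pfun (c : ℝ) (hc : 1 ≤ c) (s : ℝ) : Summable fun m => pcoef c m * s ^ m := by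
  refine Summable.of_norm_bounded (g := fun m => |s| ^ m / m.factorial) (Real.summable_pow_div_factorial _) ?_
  intro m
  rw [norm_mul, norm_pow, Real.norm_eq_abs, Real.norm_eq_abs, div_eq_mul_one_div, mul_comm]
  exact mul_le_mul_of_nonneg_left (pcoef_bound c hc m) (by positivity)

lemma pfun_hasDerivAt (c : ℝ) (hc : 1 ≤ c) (s : ℝ) :
    HasDerivAt (pfun c) (-(1 / (4 * c)) * pfun (c+1) s) s := by
  set M := |s| + 1 with hM
  have hM0 : 0 ≤ M := by positivity
  have key : HasDerivAt (fun z => ∑' m : ℕ, pcoef c m * z ^ m)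
      (∑' m : ℕ, pcoef c m * (m * s ^ (m-1))) s := by
    refine hasDerivAt_tsum_of_isPreconnected (t := Metric.ball (0:ℝ) M) (y₀ := s)
      (g := fun (m : ℕ) (z : ℝ) => pcoef c m * z ^ m) (g' := fun (m : ℕ) (z : ℝ) => pcoef c m * (m * z ^ (m-1)))
      (u := fun m : ℕ => (m:ℝ) * M ^ (m-1) / (m.factorial : ℝ)) ?_ Metric.isOpen_ball
      (convex_ball (0:ℝ) M).isPreconnected ?_ ?_ ?_ (summable_pfun c hc s) ?_
    · rw [← summable_nat_add_iff 1]
      refine (Real.summable_pow_div_factorial M).congr fun m => ?_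
      rw [Nat.factorial_succ]; push_cast; (try simp only [Nat.add_sub_cancel]); field_simp
    · intro n y _
      exact (hasDerivAt_pow n y).const_mul _
    · intro n y hy
      have hy' : |y| ≤ M := by
        have := Metric.mem_ball.1 hy; rw [dist_zero_right] at this; exact this.le
      rw [norm_mul, norm_mul, norm_pow, Real.norm_eq_abs, Real.norm_eq_abs, Real.norm_eq_abs, Nat.abs_cast]
      calc |pcoef c n| * (n * |y| ^ (n-1)) ≤ (1 / n.factorial) * (n * M ^ (n-1)) := by
            gcongr; exact pcoef_bound c hc n
        _ = _ := by ring
    · simp [hM]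
    · simp [hM]; 
  have e : (∑' m : ℕ, pcoef c m * (m * s ^ (m-1))) = -(1 / (4 * c)) * pfun (c+1) s := by
    have hs : Summable fun m : ℕ => pcoef c m * (m * s ^ (m-1)) := by
      rw [← summable_nat_add_iff 1]
      refine ((summable_pfun (c+1) (by linarith) s).mul_left (-(1 / (4 * c)))).congr fun m => ?_
      rw [← mul_assoc, ← pcoef_shift c hc m]; push_cast; (try simp only [Nat.add_sub_cancel]); ring
    rw [hs.tsum_eq_zero_add, pfun, ← tsum_mul_left]
    simp only [Nat.cast_zero, zero_mul, mul_zero, zero_add]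
    congr 1; ext m
    rw [← mul_assoc (-(1 / (4 * c))), ← pcoef_shift c hc m]; push_cast; try simp only [Nat.add_sub_cancel]
    ring
  rw [e] at key
  exact key

lemma pfun_contDiff_nat (n : ℕ) : ∀ (c : ℝ), 1 ≤ c → ContDiff ℝ n (pfun c) := by
  induction n with
  | zero => intro c hc; 
            have : Differentiable ℝ (pfun c) := fun s => (pfun_hasDerivAt c hc s).differentiableAt
            exact contDiff_zero.2 this.continuous
  | succ n ih =>
    intro c hc
    push_cast
    rw [contDiff_succ_iff_deriv]
    refine ⟨fun s => (pfun_hasDerivAt c hc s).differentiableAt, by simp, ?_⟩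
    have : deriv (pfun c) = fun s => -(1 / (4 * c)) * pfun (c+1) s := by
      ext s; exact (pfun_hasDerivAt c hc s).deriv
    rw [this]
    exact contDiff_const.mul (ih _ (by linarith))

lemma pfun_contDiff (c : ℝ) (hc : 1 ≤ c) : ContDiff ℝ (⊤ : ℕ∞) (pfun c) :=
  contDiff_infty.2 fun n => pfun_contDiff_nat n c hc

lemma pfun_contig (c : ℝ) (hc : 1 ≤ c) (s : ℝ) :
    pfun c s - pfun (c+1) s + s / (4 * c * (c+1)) * pfun (c+1+1) s = 0 := by
  have h0 : c ≠ 0 := by positivity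
  have h1 := summable_pfun c hc s
  have h2 := summable_pfun (c+1) (by linarith) s
  have h3 := summable_pfun (c+1+1) (by linarith) s
  rw [pfun, pfun, pfun, h1.tsum_eq_zero_add, h2.tsum_eq_zero_add]
  have h1' := (summable_nat_add_iff 1).2 h1
  have h2' := (summable_nat_add_iff 1).2 h2
  rw [← tsum_mul_left]
  simp only [pcoef, pow_zero]
  have := (h1'.sub h2').tsum_add (h3.mul_left (s / (4 * c * (c+1))))
  rw [h1'.tsum_sub h2'] at this
  have e : ∀ m : ℕ, pcoef c (m+1) * s^(m+1) - pcoef (c+1) (m+1) * s^(m+1) +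
     s / (4 * c * (c+1)) * (pcoef (c+1+1) m * s ^ m) = 0 := by
    intro m
    have a1 := pcoef_shift c hc m
    have a2 := pcoef_shift (c+1) (by linarith) m
    have e2 : pcoef (c+1) (m+1) = - pcoef (c+1) m / (4 * (m + 1) * (c + 1 + m)) := rfl
    have p2 : (0:ℝ) < c + 1 + m := by positivity
    have p3 : (0:ℝ) < (m:ℝ) + 1 := by positivity
    have a3 : pcoef (c+1+1) m = - (4 * (c+1)) * ((m+1) * pcoef (c+1) (m+1)) := by
      rw [a2]; field_simp
    have a4 : pcoef c (m+1) = -(1 / (4 * c)) * pcoef (c+1) m / (m+1) := by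
      rw [← a1]; field_simp
    rw [a3, a4, e2]
    field_simp
    ring
  simp only [e, tsum_zero] at this
  simp only [pcoef] at this
  linarith

lemma exists_psi0 (d : ℕ) : ∃ φ φ' φ'' : ℝ → ℝ, ContDiff ℝ (⊤ : ℕ∞) φ ∧
    (∀ s, HasDerivAt φ (φ' s) s) ∧ (∀ s, HasDerivAt φ' (φ'' s) s) ∧
    (∀ s, 4 * s * φ'' s + (2 * d + 4) * φ' s + φ s = 0) ∧ φ 0 = 1 := by
  set c : ℝ := d / 2 + 1 with hcdef
  have hc : 1 ≤ c := by rw [hcdef]; have : (0:ℝ) ≤ d := by positivity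
                        linarith
  have h0 : c ≠ 0 := by positivity
  refine ⟨pfun c, fun s => -(1 / (4 * c)) * pfun (c+1) s,
    fun s => -(1 / (4 * c)) * (-(1 / (4 * (c+1))) * pfun (c+1+1) s), pfun_contDiff c hc,
    pfun_hasDerivAt c hc, fun s => (pfun_hasDerivAt (c+1) (by linarith) s).const_mul _, ?_, ?_⟩
  · intro s
    have := pfun_contig c hc s
    have e : (2 * (d:ℝ) + 4) = 4 * c := by rw [hcdef]; ring
    rw [e]
    have p1 : c + 1 ≠ 0 := by positivity
    rw [← this]
    field_simp
    ring
  · rw [pfun, tsum_eq_single 0]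
    · simp [pcoef]
    · intro m hm; simp [hm]

/-- The radial profile of the first nonconstant Neumann eigenfunction of a ball. -/
structure IsProfile (d : ℕ) (r μ : ℝ) (φ φ' φ'' : ℝ → ℝ) : Prop where
  smooth : ContDiff ℝ (⊤ : ℕ∞) φ
  d1 : ∀ s, HasDerivAt φ (φ' s) s
  d2 : ∀ s, HasDerivAt φ' (φ'' s) s
  ode : ∀ s, 4 * s * φ'' s + (2 * d + 4) * φ' s + μ * φ s = 0
  pos : ∀ s, 0 ≤ s → s ≤ r ^ 2 → 0 < φ s
  qnn : ∀ s, 0 ≤ s → s ≤ r ^ 2 → 0 ≤ φ s + 2 * s * φ' s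
  qr : φ (r ^ 2) + 2 * r ^ 2 * φ' (r ^ 2) = 0
  mupos : 0 < μ

lemma base_profile (d : ℕ) (hd : 2 ≤ d) : ∃ (s0 : ℝ) (φ φ' φ'' : ℝ → ℝ), 0 < s0 ∧
    ContDiff ℝ (⊤ : ℕ∞) φ ∧
    (∀ s, HasDerivAt φ (φ' s) s) ∧ (∀ s, HasDerivAt φ' (φ'' s) s) ∧
    (∀ s, 4 * s * φ'' s + (2 * d + 4) * φ' s + φ s = 0) ∧
    (∀ s, 0 ≤ s → s ≤ s0 → 0 < φ s) ∧ (∀ s, 0 ≤ s → s ≤ s0 → 0 ≤ φ s + 2 * s * φ' s) ∧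
    φ s0 + 2 * s0 * φ' s0 = 0 := by
  obtain ⟨φ, φ', φ'', hs, h1, h2, ode, h00⟩ := exists_psi0 d
  set q : ℝ → ℝ := fun s => φ s + 2 * s * φ' s with hq
  have hd' : (2:ℝ) ≤ d := by exact_mod_cast hd
  have hq' : ∀ s, HasDerivAt q (-(d - 1) * φ' s - φ s / 2) s := by
    intro s
    have := (h1 s).add (((hasDerivAt_id s).const_mul 2).mul (h2 s))
    refine this.congr_deriv ?_
    have := ode s
    simp only [id, mul_one]
    linarith
  have hqc : Continuous q := continuous_iff_continuousAt.2 fun s => (hq' s).continuousAt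
  have hφc : Continuous φ := hs.continuous
  have hq0 : q 0 = 1 := by simp [hq, h00]
  -- the function g = sqrt s * φ
  have hg' : ∀ s, 0 < s → HasDerivAt (fun s => √s * φ s) (q s / (2 * √s)) s := by
    intro s hs0
    have := (Real.hasDerivAt_sqrt hs0.ne').mul (h1 s)
    refine this.congr_deriv ?_
    have hss : √s * √s = s := Real.mul_self_sqrt hs0.le
    have : √s ≠ 0 := (Real.sqrt_pos.2 hs0).ne'
    simp only [hq]
    field_simp
    rw [show √s ^ 2 = s by rw [sq, hss]]
    ring
  have gc : Continuous (fun s => √s * φ s) := Real.continuous_sqrt.mul hφc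
  have gmono : ∀ b, (∀ s, 0 ≤ s → s < b → 0 < q s) → ∀ x y, 0 ≤ x → x < y → y ≤ b →
      √x * φ x < √y * φ y := by
    intro b hb x y hx hxy hyb
    have : StrictMonoOn (fun s => √s * φ s) (Set.Icc 0 b) := by
      refine strictMonoOn_of_deriv_pos (convex_Icc 0 b) gc.continuousOn ?_
      intro t ht
      rw [interior_Icc] at ht
      rw [(hg' t ht.1).deriv]
      exact div_pos (hb t ht.1.le ht.2) (by have := Real.sqrt_pos.2 ht.1; positivity)
    exact this ⟨hx, by linarith⟩ ⟨by linarith, hyb⟩ hxy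
  have posφ : ∀ b, (∀ s, 0 ≤ s → s < b → 0 < q s) → ∀ s, 0 ≤ s → s ≤ b → 0 < φ s := by
    intro b hb s hs0 hsb
    rcases hs0.eq_or_lt with h | h
    · rw [← h, h00]; norm_num
    · have := gmono b hb 0 s le_rfl h hsb
      simp only [Real.sqrt_zero, zero_mul] at this
      exact pos_of_mul_pos_right this (Real.sqrt_nonneg s)
  have hex : ∃ s, 0 ≤ s ∧ q s ≤ 0 := by
    by_contra hcon
    push Not at hcon
    have hall : ∀ b, ∀ s, 0 ≤ s → s < b → 0 < q s := fun b s h _ => hcon s h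
    set s1 : ℝ := 2 * (d - 1) with hs1
    have hs1p : 0 < s1 := by rw [hs1]; linarith
    set g1 := √s1 * φ s1 with hg1
    have hg1p : 0 < g1 := mul_pos (Real.sqrt_pos.2 hs1p) (posφ s1 (hall s1) s1 hs1p.le le_rfl)
    have hanti : AntitoneOn (fun s => q s + g1 / 2 * √s) (Set.Ici s1) := by
      refine antitoneOn_of_deriv_nonpos (convex_Ici s1)
        (hqc.add (continuous_const.mul Real.continuous_sqrt)).continuousOn ?_ ?_
      · intro t ht
        rw [interior_Ici] at ht
        have ht0 : 0 < t := lt_trans hs1p ht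
        exact ((hq' t).add ((Real.hasDerivAt_sqrt ht0.ne').const_mul _)).differentiableAt.differentiableWithinAt
      · intro t ht
        rw [interior_Ici] at ht
        have ht0 : 0 < t := lt_trans hs1p ht
        have hd := ((hq' t).add ((Real.hasDerivAt_sqrt ht0.ne').const_mul (g1/2)))
        have e1 : deriv (fun s => q s + g1 / 2 * √s) t = _ := hd.deriv
        rw [e1]
        have hst : 0 < √t := Real.sqrt_pos.2 ht0
        have hgt : g1 ≤ √t * φ t := (gmono t (hall t) s1 t hs1p.le ht le_rfl).le
        have hφt := posφ t (hall t) t ht0.le le_rfl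
        have hqt := hcon t ht0.le
        have hqe : φ' t = (q t - φ t) / (2 * t) := by simp only [hq]; field_simp; ring
        have hA : g1 / 2 * (1 / (2 * √t)) ≤ φ t / 4 := by
          rw [show g1 / 2 * (1 / (2 * √t)) = (g1 / √t) / 4 by field_simp; ring]
          have : g1 / √t ≤ φ t := by rw [div_le_iff₀ hst]; linarith
          linarith
        have hB : -((d:ℝ) - 1) * φ' t ≤ φ t / 4 := by
          rw [hqe]
          rw [show -((d:ℝ) - 1) * ((q t - φ t) / (2 * t)) = (((d:ℝ)-1) * (φ t - q t)) / (2 * t) by field_simp; ring]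
          rw [div_le_iff₀ (by positivity)]
          have ht' : 2 * ((d:ℝ)-1) < t := ht
          nlinarith
        linarith
    set K := q s1 + g1 / 2 * √s1
    have hK : ∀ t, s1 ≤ t → g1 / 2 * √t < K := by
      intro t ht
      have := hanti (Set.mem_Ici.2 le_rfl) (Set.mem_Ici.2 ht) ht
      have h3 := hcon t (by linarith)
      have hKd : K = q s1 + g1 / 2 * √s1 := rfl
      simp only at this
      linarith
    have hKp : 0 < K := lt_of_le_of_lt (by positivity) (hK s1 le_rfl)
    have := hK (s1 + (2 * K / g1)^2) (by linarith [sq_nonneg (2 * K / g1)])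
    have h5 : 2 * K / g1 ≤ √(s1 + (2 * K / g1)^2) := by
      apply Real.le_sqrt_of_sq_le; linarith
    have h6 : g1 / 2 * (2 * K / g1) ≤ g1 / 2 * √(s1 + (2 * K / g1)^2) := by gcongr
    rw [show g1 / 2 * (2 * K / g1) = K by field_simp] at h6
    linarith
  -- first zero
  set Z : Set ℝ := {s | 0 ≤ s ∧ q s ≤ 0} with hZ
  have hZc : IsClosed Z := (isClosed_le continuous_const continuous_id).inter (isClosed_le hqc continuous_const)
  have hZb : BddBelow Z := ⟨0, fun s h => h.1⟩
  have hmem := hZc.csInf_mem hex hZb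
  set s0 := sInf Z
  have hbelow : ∀ s, 0 ≤ s → s < s0 → 0 < q s := by
    intro s hs0 hlt
    by_contra hn
    exact absurd (csInf_le hZb (⟨hs0, not_lt.1 hn⟩ : s ∈ Z)) (not_le.2 hlt)
  have hs0pos : 0 < s0 := by
    rcases hmem.1.eq_or_lt with h | h
    · have := hmem.2; rw [← h, hq0] at this; norm_num at this
    · exact h
  have hqs0 : q s0 = 0 := by
    refine le_antisymm hmem.2 ?_
    have : Tendsto q (nhdsWithin s0 (Set.Iio s0)) (nhds (q s0)) := hqc.continuousAt.tendsto.mono_left nhdsWithin_le_nhds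
    refine ge_of_tendsto this ?_
    filter_upwards [Ioo_mem_nhdsLT hs0pos] with s h
    exact (hbelow s h.1.le h.2).le
  refine ⟨s0, φ, φ', φ'', hs0pos, hs, h1, h2, ode, posφ s0 hbelow, ?_, hqs0⟩
  intro s h0 hle
  rcases hle.eq_or_lt with h | h
  · rw [h]; exact hqs0.ge
  · exact (hbelow s h0 h).le

lemma exists_profile (d : ℕ) (hd : 2 ≤ d) (r : ℝ) (hr : 0 < r) :
    ∃ (μ : ℝ) (φ φ' φ'' : ℝ → ℝ), IsProfile d r μ φ φ' φ'' := by
  obtain ⟨s0, φ, φ', φ'', hs0, hs, h1, h2, ode, hpos, hq, hqr⟩ := base_profile d hd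
  set k := s0 / r ^ 2 with hk
  have hk0 : 0 < k := by positivity
  have hkr : k * r ^ 2 = s0 := by rw [hk]; field_simp
  refine ⟨k, fun s => φ (k * s), fun s => k * φ' (k * s), fun s => k * (k * φ'' (k * s)), ?_⟩
  have hlin : ∀ s : ℝ, HasDerivAt (fun s => k * s) k s := fun s => by
    simpa using (hasDerivAt_id s).const_mul k
  have hle : ∀ s, s ≤ r ^ 2 → k * s ≤ s0 := fun s h => by rw [← hkr]; gcongr
  constructor
  · exact hs.comp (contDiff_const.mul contDiff_id)
  · intro s
    have := (h1 (k * s)).comp s (hlin s)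
    rw [mul_comm] at this; exact this
  · intro s
    have := ((h2 (k * s)).comp s (hlin s)).const_mul k
    refine this.congr_deriv ?_
    ring
  · intro s
    have := ode (k * s)
    linear_combination k * this
  · intro s h h'
    exact hpos _ (by positivity) (hle s h')
  · intro s h h'
    have := hq (k * s) (by positivity) (hle s h')
    linarith
  · rw [hkr]
    linear_combination hqr + (2 * φ' s0) * hkr
  · exact hk0

lemma intOn {d : ℕ} {Ω : Set (Euc d)} (hb : Bornology.IsBounded Ω) {f : Euc d → ℝ}
    (hf : Continuous f) : IntegrableOn f Ω :=
  (hf.continuousOn.integrableOn_compact hb.isCompact_closure).mono_set subset_closure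

lemma contDiff_normsq {d : ℕ} {u : Euc d → ℝ} (hu : ContDiff ℝ (⊤ : ℕ∞) u) :
    Continuous fun x => ‖fderiv ℝ u x‖ ^ 2 :=
  ((hu.continuous_fderiv (by simp)).norm).pow 2

lemma posint {d : ℕ} {Ω : Set (Euc d)} (ho : IsOpen Ω) (hb : Bornology.IsBounded Ω) {f : Euc d → ℝ}
    (hf : Continuous f) (hnn : ∀ x, 0 ≤ f x) (x0 : Euc d) (hx0 : x0 ∈ Ω) (hp : f x0 ≠ 0) :
    0 < ∫ x in Ω, f x := by
  rw [setIntegral_pos_iff_support_of_nonneg_ae (Eventually.of_forall hnn) (intOn hb hf)]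
  have : IsOpen (Function.support f ∩ Ω) := hf.isOpen_support.inter ho
  exact this.measure_pos _ ⟨x0, hp, hx0⟩

lemma fin2 {d : ℕ} (Ω : Set (Euc d)) (v : Euc d → ℝ) (x y : Euc d) (hx : x ∈ Ω) (hy : y ∈ Ω)
    (hxy : v x ≠ v y) :
    Module.finrank ℝ ((Submodule.span ℝ {(fun _ => 1 : Euc d → ℝ), v}).map
      (LinearMap.funLeft ℝ ℝ ((↑) : Ω → Euc d))) = 1 + 1 := by
  have hli : LinearIndependent ℝ ![LinearMap.funLeft ℝ ℝ ((↑) : Ω → Euc d) (fun _ => 1),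
      LinearMap.funLeft ℝ ℝ ((↑) : Ω → Euc d) v] := by
    rw [LinearIndependent.pair_iff]
    intro s t h
    have h1 := congrFun h ⟨x, hx⟩
    have h2 := congrFun h ⟨y, hy⟩
    simp [LinearMap.funLeft_apply] at h1 h2
    have : t * (v x - v y) = 0 := by linarith
    rcases mul_eq_zero.1 this with h3 | h3
    · subst h3; simp at h1; exact ⟨h1, rfl⟩
    · exact absurd (sub_eq_zero.1 h3) hxy
  have := finrank_span_eq_card hli
  rw [Submodule.map_span, Set.image_pair]
  rw [Matrix.range_cons, Matrix.range_cons, Matrix.range_empty, Set.union_empty, Set.singleton_union] at this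
  simpa using this

lemma span_smooth {d : ℕ} (v : Euc d → ℝ) (hv : ContDiff ℝ (⊤ : ℕ∞) v) :
    ∀ u ∈ Submodule.span ℝ {(fun _ => 1 : Euc d → ℝ), v}, ContDiff ℝ (⊤ : ℕ∞) u := by
  intro u hu
  obtain ⟨a, b, rfl⟩ := Submodule.mem_span_pair.1 hu
  exact (contDiff_const.const_smul a).add (hv.const_smul b)

lemma rayleigh_nonneg {d : ℕ} (Ω : Set (Euc d)) (u : Euc d → ℝ) : 0 ≤ rayleigh Ω u :=
  div_nonneg (integral_nonneg fun _ => by positivity) (integral_nonneg fun _ => by positivity)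

lemma neumann_le {d : ℕ} {Ω : Set (Euc d)} (ho : IsOpen Ω) (hne : Ω.Nonempty)
    (hb : Bornology.IsBounded Ω) (v : Euc d → ℝ)
    (hv : ContDiff ℝ (⊤ : ℕ∞) v)
    (hvar : 0 < (∫ x in Ω, v x ^ 2) - (∫ x in Ω, v x) ^ 2 / volume.real Ω) :
    neumannEigenvalue 1 Ω ≤ (∫ x in Ω, ‖fderiv ℝ v x‖ ^ 2) /
      ((∫ x in Ω, v x ^ 2) - (∫ x in Ω, v x) ^ 2 / volume.real Ω) := by
  have hm : 0 < volume.real Ω := by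
    rw [measureReal_def, ENNReal.toReal_pos_iff]
    exact ⟨ho.measure_pos _ hne, hb.measure_lt_top⟩
  set m := volume.real Ω with hmdef
  have hvc : Continuous v := hv.continuous
  have iv := intOn hb hvc
  have iv2 : IntegrableOn (fun x => v x ^ 2) Ω := intOn hb (hvc.pow 2)
  have i1 : IntegrableOn (fun _ : Euc d => (1:ℝ)) Ω := intOn hb continuous_const
  have hvol : ∫ _ in Ω, (1:ℝ) = m := by simp [hmdef]
  -- nonconstant
  obtain ⟨x0, hx0⟩ := hne
  have hnc : ∃ y ∈ Ω, v x0 ≠ v y := by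
    by_contra hcon
    push Not at hcon
    have e1 : ∫ x in Ω, v x = v x0 * m := by
      rw [setIntegral_congr_fun ho.measurableSet (g := fun _ => v x0) (fun y hy => (hcon y hy).symm)]
      simp [hmdef, mul_comm]
    have e2 : ∫ x in Ω, v x ^ 2 = v x0 ^ 2 * m := by
      rw [setIntegral_congr_fun ho.measurableSet (g := fun _ => v x0 ^ 2) (fun y hy => by simp only; rw [hcon y hy])]
      simp [hmdef, mul_comm]
    rw [e1, e2] at hvar
    have : v x0 ^ 2 * m - (v x0 * m) ^ 2 / m = 0 := by field_simp; ring
    linarith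
  obtain ⟨y0, hy0, hxy⟩ := hnc
  have hD : 0 ≤ ∫ x in Ω, ‖fderiv ℝ v x‖ ^ 2 := integral_nonneg fun _ => by positivity
  have hle : neumannEigenvalue 1 Ω ≤ sSup { r : ℝ | ∃ u ∈ Submodule.span ℝ {(fun _ => 1 : Euc d → ℝ), v},
      (0 < ∫ x in Ω, (u x) ^ 2) ∧ r = rayleigh Ω u } := by
    refine csInf_le ⟨0, ?_⟩ ⟨_, span_smooth v hv, fin2 Ω v x0 y0 hx0 hy0 hxy, rfl⟩
    rintro t ⟨V, -, -, rfl⟩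
    refine Real.sSup_nonneg ?_
    rintro _ ⟨u, -, -, rfl⟩
    exact rayleigh_nonneg Ω u
  refine hle.trans (Real.sSup_le ?_ (div_nonneg hD hvar.le))
  rintro _ ⟨u, hu, hpos, rfl⟩
  obtain ⟨a, b, rfl⟩ := Submodule.mem_span_pair.1 hu
  have hfd : ∀ x, ‖fderiv ℝ (a • (fun _ => 1 : Euc d → ℝ) + b • v) x‖ ^ 2 = b ^ 2 * ‖fderiv ℝ v x‖ ^ 2 := by
    intro x
    have h1 : HasFDerivAt (a • (fun _ => 1 : Euc d → ℝ) + b • v) (a • (0 : Euc d →L[ℝ] ℝ) + b • fderiv ℝ v x) x :=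
      ((hasFDerivAt_const (1:ℝ) x).const_smul a).add
        (((hv.differentiable (by simp)) x).hasFDerivAt.const_smul b)
    rw [h1.fderiv, smul_zero, zero_add, norm_smul, mul_pow]
    simp
  have hsq : ∫ x in Ω, ((a • (fun _ => 1 : Euc d → ℝ) + b • v) x) ^ 2 =
      a ^ 2 * m + 2 * a * b * (∫ x in Ω, v x) + b ^ 2 * ∫ x in Ω, v x ^ 2 := by
    have : ∀ x, ((a • (fun _ => 1 : Euc d → ℝ) + b • v) x) ^ 2 =
      a ^ 2 * 1 + 2 * a * b * v x + b ^ 2 * v x ^ 2 := by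
      intro x; simp; ring
    simp_rw [this]
    rw [integral_add, integral_add, integral_const_mul, integral_const_mul, integral_const_mul, hvol]
    · exact i1.const_mul _
    · exact iv.const_mul _
    · exact (i1.const_mul _).add (iv.const_mul _)
    · exact iv2.const_mul _
  unfold rayleigh
  rw [div_le_div_iff₀ hpos hvar]
  simp_rw [hfd]
  rw [integral_const_mul, hsq]
  set D := ∫ x in Ω, ‖fderiv ℝ v x‖ ^ 2
  set I1 := ∫ x in Ω, v x
  set I2 := ∫ x in Ω, v x ^ 2
  have key : b ^ 2 * (I2 - I1 ^ 2 / m) ≤ a ^ 2 * m + 2 * a * b * I1 + b ^ 2 * I2 := by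
    have : 0 ≤ (a * m + b * I1) ^ 2 / m := by positivity
    have e : (a * m + b * I1) ^ 2 / m = a ^ 2 * m + 2 * a * b * I1 + b ^ 2 * (I1 ^ 2 / m) := by
      field_simp; ring
    linarith
  nlinarith [mul_le_mul_of_nonneg_left key hD]

lemma basis_pair {d : ℕ} {Ω : Set (Euc d)} (V : Submodule ℝ (Euc d → ℝ))
    (h2 : Module.finrank ℝ (V.map (LinearMap.funLeft ℝ ℝ ((↑) : Ω → Euc d))) = 1 + 1) :
    ∃ u0 ∈ V, ∃ u1 ∈ V, (∀ a b : ℝ, (∀ x ∈ Ω, a * u0 x + b * u1 x = 0) → a = 0 ∧ b = 0) ∧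
      ∀ u ∈ V, ∃ a b : ℝ, ∀ x ∈ Ω, u x = a * u0 x + b * u1 x := by
  have : Module.Finite ℝ (V.map (LinearMap.funLeft ℝ ℝ ((↑) : Ω → Euc d))) :=
    Module.finite_of_finrank_pos (by rw [h2]; norm_num)
  let B := Module.finBasisOfFinrankEq ℝ _ h2
  obtain ⟨u0, hu0, e0⟩ := (B 0).2
  obtain ⟨u1, hu1, e1⟩ := (B 1).2
  refine ⟨u0, hu0, u1, hu1, ?_, ?_⟩
  · intro a b hab
    have hli := B.linearIndependent
    rw [Fintype.linearIndependent_iff] at hli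
    have := hli ![a, b] (by
      rw [Fin.sum_univ_two]
      ext ⟨x, hx⟩
      have := hab x hx
      simp only [Submodule.coe_add, Submodule.coe_smul, ← e0, ← e1]
      simpa [LinearMap.funLeft_apply] using this)
    exact ⟨this 0, this 1⟩
  · intro u hu
    let w : V.map (LinearMap.funLeft ℝ ℝ ((↑) : Ω → Euc d)) := ⟨_, Submodule.mem_map_of_mem hu⟩
    have hw := B.sum_repr w
    rw [Fin.sum_univ_two] at hw
    refine ⟨B.repr w 0, B.repr w 1, fun x hx => ?_⟩
    have := congrFun (congrArg Subtype.val hw) ⟨x, hx⟩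
    simp only [Submodule.coe_add, Submodule.coe_smul, ← e0, ← e1] at this
    simpa [LinearMap.funLeft_apply, w] using this.symm

lemma le_neumann {d : ℕ} {Ω : Set (Euc d)} (ho : IsOpen Ω)
    (hb : Bornology.IsBounded Ω) (x0 y0 : Euc d) (hx0 : x0 ∈ Ω) (hy0 : y0 ∈ Ω) (hxy : x0 ≠ y0)
    (μ : ℝ) (hP : ∀ u : Euc d → ℝ, ContDiff ℝ (⊤ : ℕ∞) u → ∫ x in Ω, u x = 0 →
      μ * ∫ x in Ω, u x ^ 2 ≤ ∫ x in Ω, ‖fderiv ℝ u x‖ ^ 2) :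
    μ ≤ neumannEigenvalue 1 Ω := by
  refine le_csInf ?_ ?_
  · set v : Euc d → ℝ := fun x => inner ℝ (x0 - y0) x with hv
    have hvs : ContDiff ℝ (⊤ : ℕ∞) v := contDiff_const.inner ℝ contDiff_id
    have hne : v x0 ≠ v y0 := by
      intro h
      have h3 : inner ℝ (x0 - y0) (x0 - y0) = (0:ℝ) := by rw [inner_sub_right]; exact sub_eq_zero.2 h
      exact hxy (sub_eq_zero.1 (inner_self_eq_zero.1 h3))
    exact ⟨_, _, span_smooth v hvs, fin2 Ω v x0 y0 hx0 hy0 hne, rfl⟩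
  rintro t ⟨V, hVs, h2, rfl⟩
  obtain ⟨u0, hu0, u1, hu1, hli, hsp⟩ := basis_pair V h2
  have c0 := hVs u0 hu0
  have c1 := hVs u1 hu1
  have sqpos : ∀ u : Euc d → ℝ, Continuous u → (∃ x ∈ Ω, u x ≠ 0) → 0 < ∫ x in Ω, u x ^ 2 := by
    rintro u hu ⟨x, hx, hne⟩
    exact posint ho hb (hu.pow 2) (fun _ => sq_nonneg _) x hx (pow_ne_zero 2 hne)
  -- a mean zero function
  have hmean : ∃ u ∈ V, (∫ x in Ω, u x = 0) ∧ 0 < ∫ x in Ω, u x ^ 2 := by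
    set I0 := ∫ x in Ω, u0 x
    set I1 := ∫ x in Ω, u1 x
    have hcomb : ∀ a b : ℝ, ∫ x in Ω, (a • u0 + b • u1) x = a * I0 + b * I1 := by
      intro a b
      simp only [Pi.add_apply, Pi.smul_apply, smul_eq_mul]
      rw [integral_add ((intOn hb c0.continuous).const_mul _) ((intOn hb c1.continuous).const_mul _),
        integral_const_mul, integral_const_mul]
    have hex : ∃ a b : ℝ, a * I0 + b * I1 = 0 ∧ ¬ (a = 0 ∧ b = 0) := by
      by_cases h : I1 = 0 ∧ I0 = 0
      · exact ⟨1, 0, by rw [h.1, h.2]; ring, by simp⟩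
      · exact ⟨I1, -I0, by ring, by rw [neg_eq_zero]; exact h⟩
    obtain ⟨a, b, h0, hne⟩ := hex
    refine ⟨a • u0 + b • u1, V.add_mem (V.smul_mem _ hu0) (V.smul_mem _ hu1), by rw [hcomb, h0], ?_⟩
    refine sqpos _ ((c0.continuous.const_smul a).add (c1.continuous.const_smul b)) ?_
    by_contra hcon
    push Not at hcon
    exact hne (hli a b (by simpa using hcon))
  obtain ⟨u, hu, hu0', hupos⟩ := hmean
  have hray : μ ≤ rayleigh Ω u := by
    unfold rayleigh
    rw [le_div_iff₀ hupos]
    exact hP u (hVs u hu) hu0'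
  refine hray.trans (le_csSup ?_ ⟨u, hu, hupos, rfl⟩)
  -- boundedness
  have hA : 0 < ∫ x in Ω, u0 x ^ 2 := by
    refine sqpos _ c0.continuous ?_
    by_contra hcon
    push Not at hcon
    have := hli 1 0 (fun x hx => by rw [hcon x hx]; ring)
    exact one_ne_zero this.1
  set A := ∫ x in Ω, u0 x ^ 2
  set t := (∫ x in Ω, u0 x * u1 x) / A with ht
  set w : Euc d → ℝ := fun x => u1 x - t * u0 x with hw
  have cw : ContDiff ℝ (⊤ : ℕ∞) w := c1.sub (contDiff_const.mul c0)
  have hC : 0 < ∫ x in Ω, w x ^ 2 := by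
    refine sqpos _ cw.continuous ?_
    by_contra hcon
    push Not at hcon
    have := hli (-t) 1 (fun x hx => by have := hcon x hx; simp only [hw] at this; linarith)
    exact one_ne_zero this.2
  set C := ∫ x in Ω, w x ^ 2
  have k0 := c0.continuous
  have k1 := c1.continuous
  have kw := cw.continuous
  have horth : ∫ x in Ω, u0 x * w x = 0 := by
    have e : ∀ x, u0 x * w x = u0 x * u1 x - t * u0 x ^ 2 := fun x => by simp only [hw]; ring
    simp_rw [e]
    have i1 : IntegrableOn (fun x => u0 x * u1 x) Ω := intOn hb (k0.mul k1)
    have i2 : IntegrableOn (fun x => u0 x ^ 2) Ω := intOn hb (k0.pow 2)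
    rw [integral_sub i1 (i2.const_mul t), integral_const_mul, ht]
    exact sub_eq_zero.2 (div_mul_cancel₀ _ hA.ne').symm
  set D0 := ∫ x in Ω, ‖fderiv ℝ u0 x‖ ^ 2
  set D1 := ∫ x in Ω, ‖fderiv ℝ w x‖ ^ 2
  have hD0 : 0 ≤ D0 := integral_nonneg fun _ => by positivity
  have hD1 : 0 ≤ D1 := integral_nonneg fun _ => by positivity
  refine ⟨2 * D0 / A + 2 * D1 / C, ?_⟩
  rintro _ ⟨f, hf, hfpos, rfl⟩
  obtain ⟨a0, b, hab⟩ := hsp f hf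
  obtain ⟨a, ha⟩ : ∃ a, a = a0 + b * t := ⟨_, rfl⟩
  have hfe : ∀ x ∈ Ω, f x = a * u0 x + b * w x := by
    intro x hx; rw [hab x hx, ha]; simp only [hw]; ring
  have hsq : ∫ x in Ω, f x ^ 2 = a ^ 2 * A + b ^ 2 * C := by
    have e : ∫ x in Ω, f x ^ 2 = ∫ x in Ω, (a ^ 2 * u0 x ^ 2 + 2 * a * b * (u0 x * w x) + b ^ 2 * w x ^ 2) := by
      refine setIntegral_congr_fun ho.measurableSet fun x hx => ?_
      rw [hfe x hx]; ring
    rw [e, integral_add, integral_add, integral_const_mul, integral_const_mul, integral_const_mul, horth]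
    · ring
    · exact (intOn hb (k0.pow 2)).const_mul _
    · exact (intOn hb (k0.mul kw)).const_mul _
    · exact ((intOn hb (k0.pow 2)).const_mul _).add ((intOn hb (k0.mul kw)).const_mul _)
    · exact (intOn hb (kw.pow 2)).const_mul _
  have hDf : ∫ x in Ω, ‖fderiv ℝ f x‖ ^ 2 ≤ 2 * a ^ 2 * D0 + 2 * b ^ 2 * D1 := by
    have : ∫ x in Ω, ‖fderiv ℝ f x‖ ^ 2 ≤ ∫ x in Ω, (2 * a ^ 2 * ‖fderiv ℝ u0 x‖ ^ 2 + 2 * b ^ 2 * ‖fderiv ℝ w x‖ ^ 2) := by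
      refine setIntegral_mono_on (intOn hb (contDiff_normsq (hVs f hf)))
        (((intOn hb (contDiff_normsq c0)).const_mul _).add ((intOn hb (contDiff_normsq cw)).const_mul _)) ho.measurableSet ?_
      intro x hx
      have h1 : HasFDerivAt (fun x => a * u0 x + b * w x) (a • fderiv ℝ u0 x + b • fderiv ℝ w x) x :=
        (((c0.differentiable (by simp)) x).hasFDerivAt.const_mul a).add
          (((cw.differentiable (by simp)) x).hasFDerivAt.const_mul b)
      have h2 : f =ᶠ[nhds x] fun x => a * u0 x + b * w x := by
        filter_upwards [ho.mem_nhds hx] with y hy using hfe y hy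
      rw [h2.fderiv_eq, h1.fderiv]
      have h3 : ‖a • fderiv ℝ u0 x + b • fderiv ℝ w x‖ ≤ |a| * ‖fderiv ℝ u0 x‖ + |b| * ‖fderiv ℝ w x‖ := by
        refine (norm_add_le _ _).trans ?_
        rw [norm_smul, norm_smul]; rfl
      have h4 : ‖a • fderiv ℝ u0 x + b • fderiv ℝ w x‖ ^ 2 ≤ (|a| * ‖fderiv ℝ u0 x‖ + |b| * ‖fderiv ℝ w x‖) ^ 2 := by
        gcongr
      refine h4.trans ?_
      have : 2 * a ^ 2 * ‖fderiv ℝ u0 x‖ ^ 2 + 2 * b ^ 2 * ‖fderiv ℝ w x‖ ^ 2 - (|a| * ‖fderiv ℝ u0 x‖ + |b| * ‖fderiv ℝ w x‖) ^ 2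
        = (|a| * ‖fderiv ℝ u0 x‖ - |b| * ‖fderiv ℝ w x‖) ^ 2 := by
        rw [← sq_abs a, ← sq_abs b]; ring
      linarith [sq_nonneg (|a| * ‖fderiv ℝ u0 x‖ - |b| * ‖fderiv ℝ w x‖)]
    refine this.trans_eq ?_
    rw [integral_add, integral_const_mul, integral_const_mul]
    · exact (intOn hb (contDiff_normsq c0)).const_mul _
    · exact (intOn hb (contDiff_normsq cw)).const_mul _
  unfold rayleigh
  rw [div_le_iff₀ hfpos, hsq]
  refine hDf.trans ?_
  have e : (2 * D0 / A + 2 * D1 / C) * (a ^ 2 * A + b ^ 2 * C) =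
    2 * a ^ 2 * D0 + 2 * b ^ 2 * D1 + (2 * D0 * b ^ 2 * C / A + 2 * D1 * a ^ 2 * A / C) := by
    field_simp; ring
  rw [e]
  have : 0 ≤ (2 * D0 * b ^ 2 * C / A + 2 * D1 * a ^ 2 * A / C) := by positivity
  linarith

lemma IsProfile.smooth' {d : ℕ} {r μ : ℝ} {φ φ' φ'' : ℝ → ℝ} (h : IsProfile d r μ φ φ' φ'') :
    ContDiff ℝ (⊤ : ℕ∞) φ' := by
  have : φ' = deriv φ := by ext s; exact (h.d1 s).deriv.symm
  rw [this]
  exact (contDiff_infty_iff_deriv.1 h.smooth).2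

/-- gradient of `x ↦ ⟪e,x⟫ φ(‖x‖²)` -/
def gradw {d : ℕ} (φ φ' : ℝ → ℝ) (e x : Euc d) : Euc d :=
  (φ (‖x‖ ^ 2)) • e + (2 * inner ℝ e x * φ' (‖x‖ ^ 2)) • x

lemma hasFDerivAt_nsq {d : ℕ} (f : ℝ → ℝ) (f' : ℝ) (x : Euc d) (h : HasDerivAt f f' (‖x‖ ^ 2)) :
    HasFDerivAt (fun x : Euc d => f (‖x‖ ^ 2)) ((2 * f') • innerSL ℝ x) x := by
  have h1 : HasFDerivAt (fun x : Euc d => ‖x‖ ^ 2) (2 • innerSL ℝ x) x :=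
    (hasStrictFDerivAt_norm_sq x).hasFDerivAt
  have := h.comp_hasFDerivAt x h1
  refine this.congr_fderiv ?_
  ext v
  simp
  ring

lemma hasFDerivAt_innerL {d : ℕ} (e x : Euc d) :
    HasFDerivAt (fun x : Euc d => (inner ℝ e x : ℝ)) (innerSL ℝ e) x :=
  (innerSL ℝ e).hasFDerivAt

lemma hasFDerivAt_w {d : ℕ} (φ φ' : ℝ → ℝ) (e x : Euc d) (h : HasDerivAt φ (φ' (‖x‖ ^ 2)) (‖x‖ ^ 2)) :
    HasFDerivAt (fun x : Euc d => (inner ℝ e x : ℝ) * φ (‖x‖ ^ 2)) (innerSL ℝ (gradw φ φ' e x)) x := by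
  have := (hasFDerivAt_innerL e x).mul (hasFDerivAt_nsq φ _ x h)
  refine this.congr_fderiv ?_
  ext v
  simp [gradw, inner_add_left, inner_smul_left]
  ring

lemma contDiff_nsq {d : ℕ} {f : ℝ → ℝ} (h : ContDiff ℝ (⊤ : ℕ∞) f) :
    ContDiff ℝ (⊤ : ℕ∞) (fun x : Euc d => f (‖x‖ ^ 2)) :=
  h.comp (contDiff_norm_sq ℝ)

lemma contDiff_gradw {d : ℕ} {φ φ' : ℝ → ℝ} (h : ContDiff ℝ (⊤ : ℕ∞) φ) (h' : ContDiff ℝ (⊤ : ℕ∞) φ') (e : Euc d) :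
    ContDiff ℝ (⊤ : ℕ∞) (gradw φ φ' e) := by
  unfold gradw
  exact ((contDiff_nsq h).smul contDiff_const).add
    (((contDiff_const.mul (contDiff_const.inner ℝ contDiff_id)).mul (contDiff_nsq h')).smul contDiff_id)

lemma ibp {d : ℕ} {r μ : ℝ} {φ φ' φ'' : ℝ → ℝ} (h : IsProfile d r μ φ φ' φ'') (e : Euc d)
    (G : Euc d → ℝ) (hG : ContDiff ℝ (⊤ : ℕ∞) G) (hc : HasCompactSupport G) :
    ∫ x, fderiv ℝ G x (gradw φ φ' e x) = μ * ∫ x, G x * (inner ℝ e x * φ (‖x‖ ^ 2)) := by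
  set b := EuclideanSpace.basisFun (Fin d) ℝ with hb
  set W : Fin d → Euc d → ℝ := fun i x => inner ℝ (b i) (gradw φ φ' e x) with hW
  have hWs : ∀ i, ContDiff ℝ (⊤ : ℕ∞) (W i) := fun i =>
    contDiff_const.inner ℝ (contDiff_gradw h.smooth h.smooth' e)
  have hGd : Differentiable ℝ G := hG.differentiable (by simp)
  have hG1 : ∀ v, Continuous fun x => fderiv ℝ G x v := fun v =>
    (hG.continuous_fderiv (by simp)).clm_apply continuous_const
  have hGs : ∀ v, HasCompactSupport fun x => fderiv ℝ G x v := fun v => hc.fderiv_apply ℝ v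
  have hW1 : ∀ i v, Continuous fun x => fderiv ℝ (W i) x v := fun i v =>
    ((hWs i).continuous_fderiv (by simp)).clm_apply continuous_const
  have I1 : ∀ i, Integrable fun x => W i x * fderiv ℝ G x (b i) := fun i =>
    ((hWs i).continuous.mul (hG1 _)).integrable_of_hasCompactSupport (hGs _).mul_left
  have I2 : ∀ i, Integrable fun x => fderiv ℝ (W i) x (b i) * G x := fun i =>
    ((hW1 i _).mul hG.continuous).integrable_of_hasCompactSupport hc.mul_left
  have I3 : ∀ i, Integrable fun x => W i x * G x := fun i =>
    ((hWs i).continuous.mul hG.continuous).integrable_of_hasCompactSupport hc.mul_left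
  have hi : ∀ i, ∫ x, W i x * fderiv ℝ G x (b i) = - ∫ x, fderiv ℝ (W i) x (b i) * G x := fun i =>
    integral_mul_fderiv_eq_neg_fderiv_mul_of_integrable (I2 i) (I1 i) (I3 i)
      (fun x _ => (hWs i).differentiable (by simp) x) (fun x _ => hGd x)
  have e1 : ∀ x, fderiv ℝ G x (gradw φ φ' e x) = ∑ i, W i x * fderiv ℝ G x (b i) := by
    intro x
    conv_lhs => rw [← b.sum_repr' (gradw φ φ' e x)]
    rw [map_sum]
    refine Finset.sum_congr rfl fun i _ => ?_
    rw [map_smul, smul_eq_mul]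
  have e2 : ∀ i x, fderiv ℝ (W i) x (b i) =
      4 * (inner ℝ e (b i) * inner ℝ (b i) x) * φ' (‖x‖ ^ 2) + 2 * inner ℝ e x * φ' (‖x‖ ^ 2)
       + 4 * inner ℝ e x * φ'' (‖x‖^2) * (inner ℝ (b i) x) ^ 2 := by
    intro i x
    have hWe : W i = fun x => inner ℝ (b i) e * φ (‖x‖ ^ 2) + (2 * (inner ℝ e x * φ' (‖x‖ ^ 2))) * inner ℝ (b i) x := by
      ext y
      simp only [hW, gradw, inner_add_right, inner_smul_right]
      ring
    have hd := ((hasFDerivAt_nsq φ _ x (h.d1 _)).const_mul (inner ℝ (b i) e)).add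
      ((((hasFDerivAt_innerL e x).mul (hasFDerivAt_nsq φ' _ x (h.d2 _))).const_mul 2).mul (hasFDerivAt_innerL (b i) x))
    rw [hWe]
    refine (congrArg (fun L : Euc d →L[ℝ] ℝ => L (b i)) hd.fderiv).trans ?_
    have hbb : inner ℝ (b i) (b i) = (1:ℝ) := by
      rw [real_inner_self_eq_norm_sq, b.norm_eq_one]; norm_num
    simp only [add_apply, smul_apply, innerSL_apply_apply, smul_eq_mul, hbb, Pi.mul_apply]
    rw [real_inner_comm (b i) x, real_inner_comm (b i) e]
    ring
  have e3 : ∀ x, ∑ i, fderiv ℝ (W i) x (b i) = - μ * (inner ℝ e x * φ (‖x‖ ^ 2)) := by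
    intro x
    simp_rw [e2]
    have s1 : ∑ i, 4 * (inner ℝ e (b i) * inner ℝ (b i) x) * φ' (‖x‖ ^ 2) = 4 * inner ℝ e x * φ' (‖x‖ ^ 2) := by
      rw [← Finset.sum_mul, ← Finset.mul_sum, b.sum_inner_mul_inner]
    have s2 : ∑ i, 4 * inner ℝ e x * φ'' (‖x‖^2) * (inner ℝ (b i) x) ^ 2 = 4 * inner ℝ e x * φ'' (‖x‖^2) * ‖x‖ ^ 2 := by
      rw [← Finset.mul_sum, b.sum_sq_inner_right]
    rw [Finset.sum_add_distrib, Finset.sum_add_distrib, s1, s2]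
    simp only [Finset.sum_const, Finset.card_univ, Fintype.card_fin, nsmul_eq_mul]
    have := h.ode (‖x‖ ^ 2)
    linear_combination (inner ℝ e x) * this
  simp_rw [e1]
  rw [integral_finsetSum _ fun i _ => I1 i]
  simp_rw [hi]
  rw [Finset.sum_neg_distrib, ← integral_finsetSum _ fun i _ => I2 i]
  simp_rw [← Finset.sum_mul, e3]
  rw [← integral_const_mul, ← integral_neg]
  congr 1; ext x; ring

/-- the cutoff -/
def kap (r ε s : ℝ) : ℝ := Real.smoothTransition ((r ^ 2 - s) / ε)

lemma kap_contDiff (r ε : ℝ) : ContDiff ℝ (⊤ : ℕ∞) (kap r ε) := by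
  unfold kap
  exact Real.smoothTransition.contDiff.comp ((contDiff_const.sub contDiff_id).div_const ε)

lemma kap_anti (r ε : ℝ) (hε : 0 < ε) : Antitone (kap r ε) := by
  intro s t hst
  exact Real.smoothTransition.monotone (by gcongr)

lemma kap_zero (r ε s : ℝ) (hε : 0 < ε) (hs : r ^ 2 ≤ s) : kap r ε s = 0 :=
  Real.smoothTransition.zero_of_nonpos (div_nonpos_of_nonpos_of_nonneg (by linarith) hε.le)

lemma kap_deriv_zero (r ε s : ℝ) (hε : 0 < ε) (hs : r ^ 2 < s) : deriv (kap r ε) s = 0 := by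
  have : kap r ε =ᶠ[nhds s] fun _ => 0 := by
    filter_upwards [lt_mem_nhds hs] with t ht using kap_zero r ε t hε ht.le
  rw [this.deriv_eq]; simp

lemma odd_pointwise (k k' a F w δ u : ℝ) (nd nw L : ℝ) (hk : 0 ≤ k)
    (ha : a = w / (w ^ 2 + δ ^ 2)) (hδ : 0 < δ) (hL : |L| ≤ nd * nw) (hF : k' ≤ 0)
    (h : F = k' + k * (((δ ^ 2 - w ^ 2) / (w ^ 2 + δ ^ 2) ^ 2) * nw ^ 2 * u ^ 2 + a * (2 * u * L))) :
    F ≤ k * (nd ^ 2 + u ^ 2 * nw ^ 2 * δ ^ 2 / (w ^ 2 + δ ^ 2) ^ 2) := by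
  have hp : 0 < w ^ 2 + δ ^ 2 := by positivity
  have h1 : a * (2 * u * L) ≤ nd ^ 2 + a ^ 2 * u ^ 2 * nw ^ 2 := by
    have : a * (2 * u * L) ≤ 2 * |a * u| * (nd * nw) := by
      calc a * (2 * u * L) = 2 * ((a * u) * L) := by ring
        _ ≤ 2 * |(a * u) * L| := by gcongr; exact le_abs_self _
        _ = 2 * |a * u| * |L| := by rw [abs_mul]; ring
        _ ≤ _ := by gcongr
    have e : a ^ 2 * u ^ 2 * nw ^ 2 = (|a * u| * nw) ^ 2 := by rw [mul_pow, sq_abs]; ring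
    rw [e]
    nlinarith [sq_nonneg (nd - |a * u| * nw)]
  have h2 : ((δ ^ 2 - w ^ 2) / (w ^ 2 + δ ^ 2) ^ 2) * nw ^ 2 * u ^ 2 + a ^ 2 * u ^ 2 * nw ^ 2
     = u ^ 2 * nw ^ 2 * δ ^ 2 / (w ^ 2 + δ ^ 2) ^ 2 := by
    rw [ha]; field_simp; ring
  rw [h]
  have h3 : ((δ ^ 2 - w ^ 2) / (w ^ 2 + δ ^ 2) ^ 2) * nw ^ 2 * u ^ 2 + a * (2 * u * L) ≤
    nd ^ 2 + u ^ 2 * nw ^ 2 * δ ^ 2 / (w ^ 2 + δ ^ 2) ^ 2 := by linarith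
  have := mul_le_mul_of_nonneg_left h3 hk
  linarith

lemma odd_step {d : ℕ} {r μ : ℝ} {φ φ' φ'' : ℝ → ℝ} (h : IsProfile d r μ φ φ' φ'')
    (hr : 0 < r) (e : Euc d) (u : Euc d → ℝ) (hu : ContDiff ℝ (⊤ : ℕ∞) u) (δ : ℝ) (hδ : 0 < δ) :
    μ * ∫ x in Metric.ball (0 : Euc d) r, kap r δ (‖x‖ ^ 2) *
      (u x ^ 2 * ((inner ℝ e x * φ (‖x‖ ^ 2)) ^ 2 / ((inner ℝ e x * φ (‖x‖ ^ 2)) ^ 2 + δ ^ 2))) ≤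
    ∫ x in Metric.ball (0 : Euc d) r, kap r δ (‖x‖ ^ 2) * (‖fderiv ℝ u x‖ ^ 2 +
      u x ^ 2 * ‖gradw φ φ' e x‖ ^ 2 * δ ^ 2 / ((inner ℝ e x * φ (‖x‖ ^ 2)) ^ 2 + δ ^ 2) ^ 2) := by
  set w : Euc d → ℝ := fun x => inner ℝ e x * φ (‖x‖ ^ 2) with hw
  have hws : ContDiff ℝ (⊤ : ℕ∞) w := (contDiff_const.inner ℝ contDiff_id).mul (contDiff_nsq h.smooth)
  have hden : ∀ x, 0 < w x ^ 2 + δ ^ 2 := fun x => by positivity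
  set χ : Euc d → ℝ := fun x => kap r δ (‖x‖ ^ 2) with hχ
  have hχs : ContDiff ℝ (⊤ : ℕ∞) χ := contDiff_nsq (kap_contDiff r δ)
  set G : Euc d → ℝ := fun x => χ x * ((w x / (w x ^ 2 + δ ^ 2)) * u x ^ 2) with hG
  have hGs : ContDiff ℝ (⊤ : ℕ∞) G :=
    hχs.mul ((hws.div ((hws.pow 2).add contDiff_const) fun x => (hden x).ne').mul (hu.pow 2))
  have hχ0 : ∀ x, x ∉ Metric.ball (0 : Euc d) r → χ x = 0 := by
    intro x hx
    simp only [Metric.mem_ball, dist_zero_right, not_lt] at hx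
    refine kap_zero r δ _ hδ ?_
    gcongr
  have hχc : HasCompactSupport χ := by
    refine HasCompactSupport.intro (isCompact_closedBall (0 : Euc d) r) fun x hx => hχ0 x fun hx' => hx (Metric.ball_subset_closedBall hx')
  have hGc : HasCompactSupport G := hχc.mul_right
  have hibp := ibp h e G hGs hGc
  have hG0 : ∀ x, G x * w x = χ x * (u x ^ 2 * (w x ^ 2 / (w x ^ 2 + δ ^ 2))) := by
    intro x; simp only [hG]; ring
  have hgc : Continuous (gradw φ φ' e) := (contDiff_gradw h.smooth h.smooth' e).continuous
  rw [setIntegral_eq_integral_of_forall_compl_eq_zero (fun x hx => by rw [show kap r δ (‖x‖ ^ 2) = 0 from hχ0 x hx, zero_mul]),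
    setIntegral_eq_integral_of_forall_compl_eq_zero (fun x hx => by rw [show kap r δ (‖x‖ ^ 2) = 0 from hχ0 x hx, zero_mul])]
  have eL : ∫ x, kap r δ (‖x‖ ^ 2) * (u x ^ 2 * (w x ^ 2 / (w x ^ 2 + δ ^ 2))) = ∫ x, G x * w x := by
    congr 1; ext x; exact (hG0 x).symm
  refine (congrArg (μ * ·) eL).trans_le (hibp.symm.trans_le ?_)
  have hKc : Continuous fun x => ‖fderiv ℝ u x‖ ^ 2 +
      u x ^ 2 * ‖gradw φ φ' e x‖ ^ 2 * δ ^ 2 / (w x ^ 2 + δ ^ 2) ^ 2 := by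
    refine ((hu.continuous_fderiv (by simp)).norm.pow 2).add ?_
    refine Continuous.div ?_ ?_ fun x => (pow_pos (hden x) 2).ne'
    · exact ((hu.continuous.pow 2).mul (hgc.norm.pow 2)).mul continuous_const
    · exact ((hws.continuous.pow 2).add continuous_const).pow 2
  refine integral_mono ?_ ?_ ?_
  · refine Continuous.integrable_of_hasCompactSupport ((hGs.continuous_fderiv (by simp)).clm_apply hgc) ?_
    refine HasCompactSupport.mono' (hGc.fderiv ℝ) ?_
    intro x hx
    refine subset_closure ?_
    intro h0
    apply hx
    simp [h0]
  · refine Continuous.integrable_of_hasCompactSupport (hχs.continuous.mul hKc) hχc.mul_right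
  intro x
  have hA : HasDerivAt (fun t : ℝ => t / (t ^ 2 + δ ^ 2)) ((δ ^ 2 - w x ^ 2) / (w x ^ 2 + δ ^ 2) ^ 2) (w x) := by
    have := (hasDerivAt_id (w x)).div (((hasDerivAt_id (w x)).pow 2).add_const (δ ^ 2)) (hden x).ne'
    refine this.congr_deriv ?_
    simp
    ring
  have hwd : HasFDerivAt w (innerSL ℝ (gradw φ φ' e x)) x := hasFDerivAt_w φ φ' e x (h.d1 _)
  have hud : HasFDerivAt u (fderiv ℝ u x) x := (hu.differentiable (by simp) x).hasFDerivAt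
  have hkd := hasFDerivAt_nsq (kap r δ) _ x (((kap_contDiff r δ).differentiable (by simp) (‖x‖ ^ 2)).hasDerivAt)
  have hGd := hkd.mul ((hA.comp_hasFDerivAt x hwd).mul (hud.pow 2))
  have hF := (congrArg (fun L : Euc d →L[ℝ] ℝ => L (gradw φ φ' e x)) hGd.fderiv)
  have hix : inner ℝ x (gradw φ φ' e x) = inner ℝ e x * (φ (‖x‖ ^ 2) + 2 * ‖x‖ ^ 2 * φ' (‖x‖ ^ 2)) := by
    simp only [gradw, inner_add_right, inner_smul_right, real_inner_self_eq_norm_sq, real_inner_comm x e]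
    ring
  refine odd_pointwise (χ x) (2 * deriv (kap r δ) (‖x‖ ^ 2) * (inner ℝ x (gradw φ φ' e x)) * ((w x / (w x ^ 2 + δ ^ 2)) * u x ^ 2))
    (w x / (w x ^ 2 + δ ^ 2)) _ (w x) δ (u x) ‖fderiv ℝ u x‖ ‖gradw φ φ' e x‖ (fderiv ℝ u x (gradw φ φ' e x))
    (Real.smoothTransition.nonneg _) rfl hδ ((fderiv ℝ u x).le_opNorm _) ?_ ?_
  · rw [hix]
    rcases le_or_gt (‖x‖ ^ 2) (r ^ 2) with hle | hgt
    · have h1 := (kap_anti r δ hδ).deriv_nonpos (x := ‖x‖ ^ 2)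
      have h2 := h.qnn (‖x‖ ^ 2) (by positivity) hle
      have h3 := h.pos (‖x‖ ^ 2) (by positivity) hle
      have : 2 * deriv (kap r δ) (‖x‖ ^ 2) * (inner ℝ e x * (φ (‖x‖ ^ 2) + 2 * ‖x‖ ^ 2 * φ' (‖x‖ ^ 2))) * (w x / (w x ^ 2 + δ ^ 2) * u x ^ 2)
        = deriv (kap r δ) (‖x‖ ^ 2) * (2 * (φ (‖x‖ ^ 2) + 2 * ‖x‖ ^ 2 * φ' (‖x‖ ^ 2)) * (inner ℝ e x) ^ 2 * φ (‖x‖ ^ 2) * u x ^ 2 / (w x ^ 2 + δ ^ 2)) := by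
        simp only [hw]; ring
      rw [this]
      refine mul_nonpos_of_nonpos_of_nonneg h1 ?_
      have := hden x
      positivity
    · rw [kap_deriv_zero r δ _ hδ hgt]; simp
  · refine hF.trans ?_
    simp only [add_apply, smul_apply, innerSL_apply_apply, smul_eq_mul, Pi.mul_apply, Function.comp, real_inner_self_eq_norm_sq, hχ]
    simp
    ring

lemma odd_ineq {d : ℕ} {r μ : ℝ} {φ φ' φ'' : ℝ → ℝ} (h : IsProfile d r μ φ φ' φ'')
    (hr : 0 < r) (e : Euc d) (u : Euc d → ℝ) (hu : ContDiff ℝ (⊤ : ℕ∞) u) (L : ℝ)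
    (hL : ∀ x ∈ Metric.ball (0 : Euc d) r, |u x| ≤ L * |inner ℝ e x|) :
    μ * ∫ x in Metric.ball (0 : Euc d) r, u x ^ 2 ≤
    ∫ x in Metric.ball (0 : Euc d) r, ‖fderiv ℝ u x‖ ^ 2 := by
  set w : Euc d → ℝ := fun x => inner ℝ e x * φ (‖x‖ ^ 2) with hw
  have hws : ContDiff ℝ (⊤ : ℕ∞) w := (contDiff_const.inner ℝ contDiff_id).mul (contDiff_nsq h.smooth)
  have hgc : Continuous (gradw φ φ' e) := (contDiff_gradw h.smooth h.smooth' e).continuous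
  have hbd : Bornology.IsBounded (Metric.ball (0 : Euc d) r) := Metric.isBounded_ball
  have hsq : ∀ x ∈ Metric.ball (0 : Euc d) r, ‖x‖ ^ 2 < r ^ 2 := by
    intro x hx
    have : ‖x‖ < r := by simpa using hx
    gcongr
  obtain ⟨s0, hs0, hmin⟩ := (isCompact_Icc (a := (0:ℝ)) (b := r ^ 2)).exists_isMinOn
    ⟨0, by constructor <;> positivity⟩ h.smooth.continuous.continuousOn
  have hm : 0 < φ s0 := h.pos s0 hs0.1 hs0.2
  set C := |L| / φ s0 with hC
  have hCu : ∀ x ∈ Metric.ball (0 : Euc d) r, u x ^ 2 ≤ C ^ 2 * w x ^ 2 := by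
    intro x hx
    have h1 := hL x hx
    have h2 : φ s0 ≤ φ (‖x‖ ^ 2) := hmin (a := ‖x‖ ^ 2) ⟨by positivity, (hsq x hx).le⟩
    have h3 : |u x| ≤ C * |w x| := by
      rw [hw, hC]
      simp only [abs_mul]
      rw [abs_of_pos (hm.trans_le h2)]
      calc |u x| ≤ L * |inner ℝ e x| := h1
        _ ≤ |L| * |inner ℝ e x| := by gcongr; exact le_abs_self _
        _ = |L| / φ s0 * (|inner ℝ e x| * φ s0) := by field_simp
        _ ≤ _ := by gcongr
    calc u x ^ 2 = |u x| ^ 2 := (sq_abs _).symm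
      _ ≤ (C * |w x|) ^ 2 := by gcongr
      _ = _ := by rw [mul_pow, sq_abs]
  set δ : ℕ → ℝ := fun n => 1 / ((n : ℝ) + 1) with hδ
  have hδp : ∀ n, 0 < δ n := fun n => by positivity
  have hδt : Tendsto δ atTop (nhds 0) := tendsto_one_div_add_atTop_nhds_zero_nat
  have hkt : ∀ x ∈ Metric.ball (0 : Euc d) r, Tendsto (fun n => kap r (δ n) (‖x‖ ^ 2)) atTop (nhds 1) := by
    intro x hx
    have := hsq x hx
    refine tendsto_const_nhds.congr' ?_
    filter_upwards [hδt.eventually_lt_const (sub_pos.2 this)] with n hn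
    refine (Real.smoothTransition.one_of_one_le ?_).symm
    rw [le_div_iff₀ (hδp n)]; linarith
  have hk0 : ∀ n s, 0 ≤ kap r (δ n) s := fun n s => Real.smoothTransition.nonneg _
  have hk1 : ∀ n s, kap r (δ n) s ≤ 1 := fun n s => Real.smoothTransition.le_one _
  have hden : ∀ n x, 0 < w x ^ 2 + δ n ^ 2 := fun n x => by have := hδp n; positivity
  have hae : ∀ {p : Euc d → Prop}, (∀ x ∈ Metric.ball (0 : Euc d) r, p x) →
     ∀ᵐ x ∂(volume.restrict (Metric.ball (0 : Euc d) r)), p x := fun {p} hp =>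
     (ae_restrict_iff' Metric.isOpen_ball.measurableSet).2 (Eventually.of_forall hp)
  have hkc : ∀ n, Continuous fun x : Euc d => kap r (δ n) (‖x‖ ^ 2) := fun n =>
    (contDiff_nsq (kap_contDiff r (δ n))).continuous
  have hu2 : ∀ x ∈ Metric.ball (0 : Euc d) r, w x = 0 → u x = 0 := by
    intro x hx h0
    have := hCu x hx
    rw [h0] at this
    have h2 : u x ^ 2 = 0 := le_antisymm (by simpa using this) (sq_nonneg _)
    simpa using h2
  have T1 : Tendsto (fun n => ∫ x in Metric.ball (0 : Euc d) r, kap r (δ n) (‖x‖ ^ 2) *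
      (u x ^ 2 * (w x ^ 2 / (w x ^ 2 + δ n ^ 2)))) atTop
      (nhds (∫ x in Metric.ball (0 : Euc d) r, u x ^ 2)) := by
    refine tendsto_integral_of_dominated_convergence (fun x => u x ^ 2) ?_ (intOn hbd (hu.continuous.pow 2)) ?_ ?_
    · intro n
      refine Continuous.aestronglyMeasurable ?_
      refine (hkc n).mul ((hu.continuous.pow 2).mul ((hws.continuous.pow 2).div ((hws.continuous.pow 2).add continuous_const) fun x => (hden n x).ne'))
    · intro n
      refine hae fun x hx => ?_
      have a1 := hk0 n (‖x‖ ^ 2)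
      have a2 := hk1 n (‖x‖ ^ 2)
      have a3 : w x ^ 2 / (w x ^ 2 + δ n ^ 2) ≤ 1 := by
        rw [div_le_one (hden n x)]; nlinarith [sq_nonneg (δ n)]
      have a4 : 0 ≤ w x ^ 2 / (w x ^ 2 + δ n ^ 2) := div_nonneg (sq_nonneg _) (hden n x).le
      rw [Real.norm_eq_abs, abs_of_nonneg (by positivity)]
      calc _ ≤ 1 * (u x ^ 2 * 1) := by gcongr
        _ = _ := by ring
    · refine hae fun x hx => ?_
      by_cases h0 : w x = 0
      · simp [hu2 x hx h0]
      · have : Tendsto (fun n => w x ^ 2 / (w x ^ 2 + δ n ^ 2)) atTop (nhds (w x ^ 2 / (w x ^ 2 + 0 ^ 2))) :=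
          Tendsto.div tendsto_const_nhds (tendsto_const_nhds.add (hδt.pow 2)) (by positivity)
        have e1 : w x ^ 2 / (w x ^ 2 + 0 ^ 2) = 1 := by field_simp; simp
        rw [e1] at this
        simpa using (hkt x hx).mul (tendsto_const_nhds (x := u x ^ 2) |>.mul this)
  have T2 : Tendsto (fun n => ∫ x in Metric.ball (0 : Euc d) r, kap r (δ n) (‖x‖ ^ 2) * (‖fderiv ℝ u x‖ ^ 2 +
      u x ^ 2 * ‖gradw φ φ' e x‖ ^ 2 * δ n ^ 2 / (w x ^ 2 + δ n ^ 2) ^ 2)) atTop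
      (nhds (∫ x in Metric.ball (0 : Euc d) r, ‖fderiv ℝ u x‖ ^ 2)) := by
    have hfc : Continuous fun x => ‖fderiv ℝ u x‖ ^ 2 := (hu.continuous_fderiv (by simp)).norm.pow 2
    refine tendsto_integral_of_dominated_convergence (fun x => ‖fderiv ℝ u x‖ ^ 2 + C ^ 2 * ‖gradw φ φ' e x‖ ^ 2) ?_
      (intOn hbd (hfc.add (continuous_const.mul (hgc.norm.pow 2)))) ?_ ?_
    · intro n
      refine Continuous.aestronglyMeasurable ?_
      refine (hkc n).mul (hfc.add (Continuous.div ?_ ?_ fun x => (pow_pos (hden n x) 2).ne'))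
      · exact ((hu.continuous.pow 2).mul (hgc.norm.pow 2)).mul continuous_const
      · exact ((hws.continuous.pow 2).add continuous_const).pow 2
    · intro n
      refine hae fun x hx => ?_
      have a1 := hk0 n (‖x‖ ^ 2)
      have a2 := hk1 n (‖x‖ ^ 2)
      have a3 : u x ^ 2 * ‖gradw φ φ' e x‖ ^ 2 * δ n ^ 2 / (w x ^ 2 + δ n ^ 2) ^ 2 ≤ C ^ 2 * ‖gradw φ φ' e x‖ ^ 2 := by
        rw [div_le_iff₀ (pow_pos (hden n x) 2)]
        have b1 := hCu x hx
        calc u x ^ 2 * ‖gradw φ φ' e x‖ ^ 2 * δ n ^ 2 ≤ (C ^ 2 * w x ^ 2) * ‖gradw φ φ' e x‖ ^ 2 * δ n ^ 2 := by gcongr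
          _ = C ^ 2 * ‖gradw φ φ' e x‖ ^ 2 * (w x ^ 2 * δ n ^ 2) := by ring
          _ ≤ _ := by
            gcongr
            nlinarith [sq_nonneg (w x ^ 2), sq_nonneg (δ n ^ 2), mul_nonneg (sq_nonneg (w x)) (sq_nonneg (δ n))]
      have a4 := hden n x
      rw [Real.norm_eq_abs, abs_of_nonneg (by positivity)]
      calc _ ≤ 1 * (‖fderiv ℝ u x‖ ^ 2 + C ^ 2 * ‖gradw φ φ' e x‖ ^ 2) := by gcongr
        _ = _ := by ring
    · refine hae fun x hx => ?_
      by_cases h0 : w x = 0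
      · simp only [hu2 x hx h0]
        simpa using (hkt x hx).mul (tendsto_const_nhds (x := ‖fderiv ℝ u x‖ ^ 2))
      · have : Tendsto (fun n => u x ^ 2 * ‖gradw φ φ' e x‖ ^ 2 * δ n ^ 2 / (w x ^ 2 + δ n ^ 2) ^ 2) atTop
          (nhds (u x ^ 2 * ‖gradw φ φ' e x‖ ^ 2 * 0 ^ 2 / (w x ^ 2 + 0 ^ 2) ^ 2)) :=
          Tendsto.div (tendsto_const_nhds.mul (hδt.pow 2)) ((tendsto_const_nhds.add (hδt.pow 2)).pow 2) (by positivity)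
        have := (hkt x hx).mul ((tendsto_const_nhds (x := ‖fderiv ℝ u x‖ ^ 2)).add this)
        simpa using this
  exact le_of_tendsto_of_tendsto' (T1.const_mul μ) T2 fun n => odd_step h hr e u hu (δ n) (hδp n)

lemma ball_integral_comp {d : ℕ} (r : ℝ) (R : Euc d ≃ₗᵢ[ℝ] Euc d) (g : Euc d → ℝ) :
    ∫ x in Metric.ball (0 : Euc d) r, g (R x) = ∫ x in Metric.ball (0 : Euc d) r, g x := by
  have h := R.measurePreserving.setIntegral_preimage_emb R.toHomeomorph.measurableEmbedding g (Metric.ball 0 r)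
  have e : R ⁻¹' Metric.ball (0 : Euc d) r = Metric.ball (0 : Euc d) r := by
    ext x; simp
  rw [e] at h
  exact h

lemma norm_fderiv_comp_iso {d : ℕ} (R : Euc d ≃ₗᵢ[ℝ] Euc d) (k : Euc d → ℝ) (hk : ContDiff ℝ (⊤ : ℕ∞) k) (x : Euc d) :
    ‖fderiv ℝ (fun x => k (R x)) x‖ = ‖fderiv ℝ k (R x)‖ := by
  have h1 : HasFDerivAt (fun x => k (R x)) ((fderiv ℝ k (R x)).comp (R : Euc d →L[ℝ] Euc d)) x :=
    ((hk.differentiable (by simp) (R x)).hasFDerivAt).comp x (R : Euc d →L[ℝ] Euc d).hasFDerivAt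
  rw [h1.fderiv]
  exact ContinuousLinearMap.opNorm_comp_linearIsometryEquiv _ R

lemma dual_parallelogram {d : ℕ} (a b : Euc d →L[ℝ] ℝ) :
    ‖a + b‖ ^ 2 + ‖a - b‖ ^ 2 = 2 * (‖a‖ ^ 2 + ‖b‖ ^ 2) := by
  have h := parallelogram_law_with_norm ℝ ((InnerProductSpace.toDual ℝ (Euc d)).symm a) ((InnerProductSpace.toDual ℝ (Euc d)).symm b)
  rw [← map_add, ← map_sub] at h
  simp only [LinearIsometryEquiv.norm_map] at h
  nlinarith [h]

lemma sym_decomp {d : ℕ} (r : ℝ) (R : Euc d ≃ₗᵢ[ℝ] Euc d) (k : Euc d → ℝ) (hk : ContDiff ℝ (⊤ : ℕ∞) k) :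
    (∫ x in Metric.ball (0 : Euc d) r, k x ^ 2 =
      (∫ x in Metric.ball (0 : Euc d) r, (1 / 2 * (k x + k (R x))) ^ 2) +
       ∫ x in Metric.ball (0 : Euc d) r, (1 / 2 * (k x - k (R x))) ^ 2) ∧
    (∫ x in Metric.ball (0 : Euc d) r, ‖fderiv ℝ k x‖ ^ 2 =
      (∫ x in Metric.ball (0 : Euc d) r, ‖fderiv ℝ (fun x => (1 / 2 * (k x + k (R x)))) x‖ ^ 2) +
       ∫ x in Metric.ball (0 : Euc d) r, ‖fderiv ℝ (fun x => (1 / 2 * (k x - k (R x)))) x‖ ^ 2) := by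
  have hbd : Bornology.IsBounded (Metric.ball (0 : Euc d) r) := Metric.isBounded_ball
  have hR : ContDiff ℝ (⊤ : ℕ∞) (fun x => k (R x)) := hk.comp R.contDiff
  have hP : ContDiff ℝ (⊤ : ℕ∞) (fun x => (1 / 2 * (k x + k (R x)))) := contDiff_const.mul (hk.add hR)
  have hO : ContDiff ℝ (⊤ : ℕ∞) (fun x => (1 / 2 * (k x - k (R x)))) := contDiff_const.mul (hk.sub hR)
  constructor
  · have j1 : IntegrableOn (fun x => (1 / 2 * (k x + k (R x))) ^ 2) (Metric.ball (0 : Euc d) r) := intOn hbd (hP.continuous.pow 2)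
    have j2 : IntegrableOn (fun x => (1 / 2 * (k x - k (R x))) ^ 2) (Metric.ball (0 : Euc d) r) := intOn hbd (hO.continuous.pow 2)
    rw [← integral_add j1 j2]
    have e : ∀ x, (1 / 2 * (k x + k (R x))) ^ 2 + (1 / 2 * (k x - k (R x))) ^ 2 = 1 / 2 * k x ^ 2 + 1 / 2 * (k (R x)) ^ 2 := fun x => by ring
    have i1 : IntegrableOn (fun x => 1 / 2 * k x ^ 2) (Metric.ball (0 : Euc d) r) := intOn hbd (continuous_const.mul (hk.continuous.pow 2))
    have i2 : IntegrableOn (fun x => 1 / 2 * k (R x) ^ 2) (Metric.ball (0 : Euc d) r) := intOn hbd (continuous_const.mul (hR.continuous.pow 2))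
    simp_rw [e]
    rw [integral_add i1 i2, ball_integral_comp r R (fun x => 1 / 2 * k x ^ 2), integral_const_mul]
    ring
  · have c : ∀ {g : Euc d → ℝ}, ContDiff ℝ (⊤ : ℕ∞) g → IntegrableOn (fun x => ‖fderiv ℝ g x‖ ^ 2) (Metric.ball (0 : Euc d) r) :=
      fun hg => intOn hbd ((hg.continuous_fderiv (by simp)).norm.pow 2)
    rw [← integral_add (c hP) (c hO)]
    have hkd : ∀ x, HasFDerivAt k (fderiv ℝ k x) x := fun x => (hk.differentiable (by simp) x).hasFDerivAt
    have hRd : ∀ x, HasFDerivAt (fun x => k (R x)) (fderiv ℝ (fun x => k (R x)) x) x := fun x => (hR.differentiable (by simp) x).hasFDerivAt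
    have e : ∀ x, ‖fderiv ℝ (fun x => (1 / 2 * (k x + k (R x)))) x‖ ^ 2 + ‖fderiv ℝ (fun x => (1 / 2 * (k x - k (R x)))) x‖ ^ 2
       = 1 / 2 * ‖fderiv ℝ k x‖ ^ 2 + 1 / 2 * ‖fderiv ℝ k (R x)‖ ^ 2 := by
      intro x
      have e1 : fderiv ℝ (fun x => (1 / 2 * (k x + k (R x)))) x = (1 / 2 : ℝ) • (fderiv ℝ k x + fderiv ℝ (fun x => k (R x)) x) :=
        (((hkd x).add (hRd x)).const_mul (1 / 2)).fderiv
      have e2 : fderiv ℝ (fun x => (1 / 2 * (k x - k (R x)))) x = (1 / 2 : ℝ) • (fderiv ℝ k x - fderiv ℝ (fun x => k (R x)) x) :=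
        (((hkd x).sub (hRd x)).const_mul (1 / 2)).fderiv
      have := dual_parallelogram (fderiv ℝ k x) (fderiv ℝ (fun x => k (R x)) x)
      rw [e1, e2, norm_smul, norm_smul, ← norm_fderiv_comp_iso R k hk x]
      norm_num
      linarith
    have i1 : IntegrableOn (fun x => 1 / 2 * ‖fderiv ℝ k x‖ ^ 2) (Metric.ball (0 : Euc d) r) := (c hk).const_mul _
    have i2 : IntegrableOn (fun x => 1 / 2 * ‖fderiv ℝ k (R x)‖ ^ 2) (Metric.ball (0 : Euc d) r) :=
      intOn hbd (continuous_const.mul (((hk.continuous_fderiv (by simp)).norm.pow 2).comp R.continuous))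
    simp_rw [e]
    rw [integral_add i1 i2, ball_integral_comp r R (fun x => 1 / 2 * ‖fderiv ℝ k x‖ ^ 2), integral_const_mul]
    ring

lemma lip_small {d : ℕ} {r : ℝ} (hr : 0 < r) (L : ℝ) (hL : 0 ≤ L) (δ : ℝ) (hδ : 0 < δ) :
    ∃ ε > 0, ∀ u : Euc d → ℝ, Continuous u → (∀ x ∈ Metric.ball (0 : Euc d) r, ∀ y ∈ Metric.ball (0 : Euc d) r, |u x - u y| ≤ L * ‖x - y‖) →
      (∫ x in Metric.ball (0 : Euc d) r, u x ^ 2 ≤ ε) → ∀ x ∈ Metric.ball (0 : Euc d) r, |u x| ≤ δ := by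
  set η := min r (δ / (2 * (L + 1))) with hη
  have hη0 : 0 < η := lt_min hr (by positivity)
  have hη1 : η ≤ r := min_le_left _ _
  have hη2 : L * η ≤ δ / 2 := by
    have : η ≤ δ / (2 * (L + 1)) := min_le_right _ _
    rw [le_div_iff₀ (by positivity)] at this
    nlinarith
  have hv : 0 < volume.real (Metric.ball (0 : Euc d) (η / 2)) :=
    ENNReal.toReal_pos (Metric.measure_ball_pos volume _ (by positivity)).ne' measure_ball_lt_top.ne
  refine ⟨(δ / 2) ^ 2 * volume.real (Metric.ball (0 : Euc d) (η / 2)) / 2, by positivity, ?_⟩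
  intro u hu hlip hIntg x hx
  by_contra! hcon
  have hxr : ‖x‖ < r := by simpa using hx
  have hbd : Bornology.IsBounded (Metric.ball (0 : Euc d) r) := Metric.isBounded_ball
  set c := (1 - η / (2 * r)) • x with hc
  have hq : η / (2 * r) ≤ 1 / 2 := by
    rw [div_le_div_iff₀ (by positivity) (by norm_num)]; linarith
  have hq0 : 0 < η / (2 * r) := by positivity
  have hqr : η / (2 * r) * r = η / 2 := by field_simp
  have hsub : ∀ y ∈ Metric.ball c (η / 2), y ∈ Metric.ball (0 : Euc d) r ∧ ‖x - y‖ ≤ η := by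
    intro y hy
    rw [Metric.mem_ball, dist_eq_norm] at hy
    constructor
    · have : ‖c‖ = (1 - η / (2 * r)) * ‖x‖ := by
        rw [hc, norm_smul, Real.norm_eq_abs, abs_of_nonneg (by linarith)]
      have h2 : ‖y‖ ≤ ‖y - c‖ + ‖c‖ := by simpa using norm_add_le (y - c) c
      rw [mem_ball_zero_iff]
      nlinarith
    · have e : x - y = (η / (2 * r)) • x - (y - c) := by rw [hc, sub_smul, one_smul]; abel
      rw [e]
      refine (norm_sub_le _ _).trans ?_
      rw [norm_smul, Real.norm_eq_abs, abs_of_pos hq0]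
      nlinarith
  have hb : ∀ y ∈ Metric.ball c (η / 2), (δ / 2) ^ 2 ≤ u y ^ 2 := by
    intro y hy
    obtain ⟨h1, h2⟩ := hsub y hy
    have h3 := hlip x hx y h1
    have h4 : |u x| - |u y| ≤ |u x - u y| := abs_sub_abs_le_abs_sub _ _
    have h5 : L * ‖x - y‖ ≤ L * η := by gcongr
    rw [← sq_abs (u y)]
    gcongr
    linarith
  have i1 : ∫ y in Metric.ball c (η / 2), (δ / 2) ^ 2 ≤ ∫ y in Metric.ball c (η / 2), u y ^ 2 :=
    setIntegral_mono_on (intOn Metric.isBounded_ball continuous_const) (intOn Metric.isBounded_ball (hu.pow 2)) Metric.isOpen_ball.measurableSet hb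
  have i2 : ∫ y in Metric.ball c (η / 2), u y ^ 2 ≤ ∫ y in Metric.ball (0 : Euc d) r, u y ^ 2 :=
    setIntegral_mono_set (intOn hbd (hu.pow 2)) (Eventually.of_forall fun y => sq_nonneg _)
      (HasSubset.Subset.eventuallyLE fun y hy => (hsub y hy).1)
  have i3 : volume.real (Metric.ball c (η / 2)) = volume.real (Metric.ball (0 : Euc d) (η / 2)) := by
    simp only [Measure.real, Measure.addHaar_ball_center]
  rw [setIntegral_const, i3, smul_eq_mul] at i1
  have : 0 < (δ / 2) ^ 2 * volume.real (Metric.ball (0 : Euc d) (η / 2)) := by positivity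
  linarith

lemma refl_sub {d : ℕ} (e x : Euc d) (he : e ≠ 0) :
    ‖x - (ℝ ∙ e)ᗮ.reflection x‖ = 2 * |inner ℝ e x| / ‖e‖ := by
  have h1 : (ℝ ∙ e)ᗮ.reflection x = x - (2 * (inner ℝ e x / ‖e‖ ^ 2)) • e := by
    rw [Submodule.reflection_orthogonal_apply, Submodule.reflection_singleton_apply]
    simp [two_mul, add_smul, two_smul]
  have hn : 0 < ‖e‖ := norm_pos_iff.2 he
  rw [h1, sub_sub_cancel, norm_smul, Real.norm_eq_abs, abs_mul, abs_div, abs_of_pos (show (0:ℝ) < ‖e‖ ^ 2 by positivity)]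
  norm_num
  field_simp

lemma exists_lip {d : ℕ} (r : ℝ) (f : Euc d → ℝ) (hf : ContDiff ℝ (⊤ : ℕ∞) f) :
    ∃ L, 0 ≤ L ∧ ∀ x ∈ Metric.ball (0 : Euc d) r, ∀ y ∈ Metric.ball (0 : Euc d) r, |f x - f y| ≤ L * ‖x - y‖ := by
  obtain ⟨C, hC⟩ := (isCompact_closedBall (0 : Euc d) r).exists_bound_of_continuousOn
    (hf.continuous_fderiv (by simp)).continuousOn
  refine ⟨|C|, abs_nonneg _, fun x hx y hy => ?_⟩
  exact (convex_ball (0 : Euc d) r).norm_image_sub_le_of_norm_fderiv_le (𝕜 := ℝ)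
    (fun z _ => hf.differentiable (by simp) z)
    (fun z hz => (hC z (Metric.ball_subset_closedBall hz)).trans (le_abs_self C)) hy hx

lemma exists_sym {d : ℕ} {r μ : ℝ} {φ φ' φ'' : ℝ → ℝ} (h : IsProfile d r μ φ φ' φ'')
    (hr : 0 < r) (f : Euc d → ℝ) (hf : ContDiff ℝ (⊤ : ℕ∞) f) (hf0 : ∫ x in Metric.ball (0 : Euc d) r, f x = 0)
    (δ : ℝ) (hδ : 0 < δ) :
    ∃ k : Euc d → ℝ, ContDiff ℝ (⊤ : ℕ∞) k ∧ ∫ x in Metric.ball (0 : Euc d) r, k x = 0 ∧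
     (∫ x in Metric.ball (0 : Euc d) r, ‖fderiv ℝ k x‖ ^ 2) - μ * (∫ x in Metric.ball (0 : Euc d) r, k x ^ 2) ≤
     (∫ x in Metric.ball (0 : Euc d) r, ‖fderiv ℝ f x‖ ^ 2) - μ * (∫ x in Metric.ball (0 : Euc d) r, f x ^ 2) ∧
     ∀ x ∈ Metric.ball (0 : Euc d) r, ∀ y ∈ Metric.ball (0 : Euc d) r, ‖x‖ = ‖y‖ → |k x - k y| ≤ δ := by
  obtain ⟨L, hL0, hL⟩ := exists_lip r f hf
  have hbd : Bornology.IsBounded (Metric.ball (0 : Euc d) r) := Metric.isBounded_ball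
  set S : Set (Euc d → ℝ) := {k | ContDiff ℝ (⊤ : ℕ∞) k ∧ ∫ x in Metric.ball (0 : Euc d) r, k x = 0 ∧
     (∫ x in Metric.ball (0 : Euc d) r, ‖fderiv ℝ k x‖ ^ 2) - μ * (∫ x in Metric.ball (0 : Euc d) r, k x ^ 2) ≤
     (∫ x in Metric.ball (0 : Euc d) r, ‖fderiv ℝ f x‖ ^ 2) - μ * (∫ x in Metric.ball (0 : Euc d) r, f x ^ 2) ∧
     ∀ x ∈ Metric.ball (0 : Euc d) r, ∀ y ∈ Metric.ball (0 : Euc d) r, |k x - k y| ≤ L * ‖x - y‖} with hS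
  have hfS : f ∈ S := ⟨hf, hf0, le_rfl, hL⟩
  obtain ⟨ε, hε, hsm⟩ := lip_small (d := d) hr L hL0 (δ / 2) (by positivity)
  set N : (Euc d → ℝ) → ℝ := fun k => ∫ x in Metric.ball (0 : Euc d) r, k x ^ 2 with hN
  have hbb : BddBelow (N '' S) := ⟨0, by
    rintro _ ⟨k, _, rfl⟩
    exact integral_nonneg fun x => sq_nonneg _⟩
  obtain ⟨_, ⟨k, hkS, rfl⟩, hklt⟩ := exists_lt_of_csInf_lt (⟨_, f, hfS, rfl⟩ : (N '' S).Nonempty)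
    (show sInf (N '' S) < sInf (N '' S) + ε by linarith)
  obtain ⟨hk, hk0, hkQ, hkL⟩ := hkS
  refine ⟨k, hk, hk0, hkQ, ?_⟩
  intro x hx y hy hxy
  by_cases hne : x = y
  · rw [hne]; simp [hδ.le]
  set e := x - y with he
  have hee : e ≠ 0 := sub_ne_zero.2 hne
  set R := (ℝ ∙ e)ᗮ.reflection with hRd
  have hRx : R x = y := Submodule.reflection_sub hxy
  have hRB : ∀ z, z ∈ Metric.ball (0 : Euc d) r → R z ∈ Metric.ball (0 : Euc d) r := by
    intro z hz
    simpa using hz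
  obtain ⟨d1, d2⟩ := sym_decomp r R k hk
  have hR : ContDiff ℝ (⊤ : ℕ∞) (fun x => k (R x)) := hk.comp R.contDiff
  have hP : ContDiff ℝ (⊤ : ℕ∞) (fun x => (1 / 2 * (k x + k (R x)))) := contDiff_const.mul (hk.add hR)
  have hO : ContDiff ℝ (⊤ : ℕ∞) (fun x => (1 / 2 * (k x - k (R x)))) := contDiff_const.mul (hk.sub hR)
  have hRL : ∀ z ∈ Metric.ball (0 : Euc d) r, ∀ t ∈ Metric.ball (0 : Euc d) r, |k (R z) - k (R t)| ≤ L * ‖z - t‖ := by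
    intro z hz t ht
    have := hkL _ (hRB z hz) _ (hRB t ht)
    rwa [← map_sub, LinearIsometryEquiv.norm_map] at this
  have hodd := odd_ineq h hr e _ hO (L / ‖e‖) (by
    intro z hz
    have h1 := hkL z hz _ (hRB z hz)
    rw [refl_sub e z hee] at h1
    rw [abs_mul]
    calc |(1 / 2 : ℝ)| * |k z - k (R z)| ≤ |(1 / 2 : ℝ)| * (L * (2 * |inner ℝ e z| / ‖e‖)) := by gcongr
      _ = _ := by norm_num; ring)
  have hPS : (fun x => (1 / 2 * (k x + k (R x)))) ∈ S := by
    refine ⟨hP, ?_, ?_, ?_⟩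
    · rw [integral_const_mul, integral_add (intOn hbd hk.continuous) (intOn hbd hR.continuous), ball_integral_comp r R k, hk0]
      simp
    · refine le_trans ?_ hkQ
      rw [d1, d2]
      linarith
    · intro z hz t ht
      have h1 := abs_le.1 (hkL z hz t ht)
      have h2 := abs_le.1 (hRL z hz t ht)
      rw [abs_le]
      constructor <;> linarith [h1.1, h1.2, h2.1, h2.2]
  have hm : sInf (N '' S) ≤ N (fun x => (1 / 2 * (k x + k (R x)))) := csInf_le hbb ⟨_, hPS, rfl⟩
  have hfin := hsm _ hO.continuous (by
    intro z hz t ht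
    have h1 := abs_le.1 (hkL z hz t ht)
    have h2 := abs_le.1 (hRL z hz t ht)
    rw [abs_le]
    constructor <;> linarith [h1.1, h1.2, h2.1, h2.2]) (by
      simp only [hN] at hm hklt
      linarith) x hx
  rw [hRx, abs_mul] at hfin
  norm_num at hfin
  linarith

lemma radial_zero {n : ℕ} {r μ : ℝ} {φ φ' φ'' : ℝ → ℝ} (h : IsProfile (n + 1) r μ φ φ' φ'')
    (hr : 0 < r) (f f' : ℝ → ℝ) (hf : ∀ t, HasDerivAt f (f' t) t) (hf' : Continuous f')
    (h0 : ∫ t in (0:ℝ)..r, t ^ n * f t = 0) :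
    0 ≤ ∫ t in (0:ℝ)..r, t ^ n * (f' t ^ 2 - μ * f t ^ 2) := by
  have hfc : Continuous f := continuous_iff_continuousAt.2 fun t => (hf t).continuousAt
  have hc1 : Continuous fun t : ℝ => t ^ n * f t := by fun_prop
  have hc2 : Continuous fun t : ℝ => t ^ n * (f' t ^ 2 - μ * f t ^ 2) := by fun_prop
  set F : ℝ → ℝ := fun t => ∫ s in (0:ℝ)..t, s ^ n * f s with hF
  have hFd : ∀ t, HasDerivAt F (t ^ n * f t) t := fun t => (hc1.integral_hasStrictDerivAt 0 t).hasDerivAt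
  have hFc : Continuous F := continuous_iff_continuousAt.2 fun t => (hFd t).continuousAt
  set I : ℝ → ℝ := fun t => ∫ s in (0:ℝ)..t, s ^ n * (f' s ^ 2 - μ * f s ^ 2) with hI
  have hId : ∀ t, HasDerivAt I (t ^ n * (f' t ^ 2 - μ * f t ^ 2)) t := fun t => (hc2.integral_hasStrictDerivAt 0 t).hasDerivAt
  have hIc : Continuous I := continuous_iff_continuousAt.2 fun t => (hId t).continuousAt
  have hφ'c : Continuous φ' := h.smooth'.continuous
  have hφc : Continuous φ := h.smooth.continuous
  set N : ℝ → ℝ := fun t => (n + 1) * φ (t ^ 2) + 2 * t ^ 2 * φ' (t ^ 2) with hN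
  have hNc : Continuous N := by fun_prop
  have hsqd : ∀ t : ℝ, HasDerivAt (fun t : ℝ => t ^ 2) (2 * t) t := fun t => by
    simpa using hasDerivAt_pow 2 t
  have hφd : ∀ t, HasDerivAt (fun t => φ (t ^ 2)) (φ' (t ^ 2) * (2 * t)) t := fun t =>
    (h.d1 (t ^ 2)).comp t (hsqd t)
  have hφ'd : ∀ t, HasDerivAt (fun t => φ' (t ^ 2)) (φ'' (t ^ 2) * (2 * t)) t := fun t =>
    (h.d2 (t ^ 2)).comp t (hsqd t)
  have hNd : ∀ t, HasDerivAt N (- μ * t * φ (t ^ 2)) t := by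
    intro t
    have := ((hφd t).const_mul ((n : ℝ) + 1)).add (((hsqd t).const_mul 2).mul (hφ'd t))
    refine this.congr_deriv ?_
    have o := h.ode (t ^ 2)
    push_cast at o
    linear_combination t * o
  have hpos : ∀ t, 0 ≤ t → t ≤ r → 0 < φ (t ^ 2) := fun t h1 h2 => h.pos _ (by positivity) (by gcongr)
  set K : ℝ → ℝ := fun t => I t - μ * ((N t / φ (t ^ 2)) * (F t ^ 2 / t ^ (n + 1))) + 2 * μ * (f t * F t) with hK
  obtain ⟨C, hC⟩ := (isCompact_Icc (a := (0:ℝ)) (b := r)).exists_bound_of_continuousOn hfc.continuousOn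
  have hFb : ∀ t, 0 ≤ t → t ≤ r → |F t| ≤ C * t ^ (n + 1) := by
    intro t h1 h2
    have := intervalIntegral.norm_integral_le_of_norm_le_const (a := 0) (b := t) (C := C * t ^ n) (f := fun s => s ^ n * f s) (by
      intro s hs
      rw [Set.uIoc_of_le h1] at hs
      have := hC s ⟨hs.1.le, hs.2.trans h2⟩
      have hs0 := hs.1
      have hC0 : 0 ≤ C := (norm_nonneg _).trans this
      rw [norm_mul, norm_pow, Real.norm_of_nonneg hs.1.le, mul_comm C]
      gcongr
      exact hs.2)
    rw [sub_zero, abs_of_nonneg h1] at this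
    calc |F t| ≤ _ := this
      _ = _ := by ring
  have hKc : ContinuousOn K (Set.Icc 0 r) := by
    refine ((hIc.continuousOn.sub (continuousOn_const.mul (ContinuousOn.mul ?_ ?_))).add ?_)
    · exact hNc.continuousOn.div (by fun_prop) fun t ht => (hpos t ht.1 ht.2).ne'
    · intro t ht
      rcases ht.1.eq_or_lt with h0 | h0
      · subst h0
        have e0 : F 0 ^ 2 / (0:ℝ) ^ (n + 1) = 0 := by simp
        show Tendsto _ _ (nhds (F 0 ^ 2 / (0:ℝ) ^ (n + 1)))
        rw [e0]
        have hb : Tendsto (fun t : ℝ => C ^ 2 * t ^ (n + 1)) (nhdsWithin 0 (Set.Icc 0 r)) (nhds 0) := by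
          have : Continuous fun t : ℝ => C ^ 2 * t ^ (n + 1) := by fun_prop
          have := this.continuousWithinAt (s := Set.Icc 0 r) (x := 0)
          simpa [ContinuousWithinAt] using this
        refine squeeze_zero_norm' ?_ hb
        filter_upwards [self_mem_nhdsWithin] with s hs
        rcases hs.1.eq_or_lt with h1 | h1
        · rw [← h1]; simp
        · have := hFb s hs.1 hs.2
          rw [Real.norm_of_nonneg (by positivity), div_le_iff₀ (by positivity), ← sq_abs]
          calc |F s| ^ 2 ≤ (C * s ^ (n + 1)) ^ 2 := by gcongr
            _ = _ := by ring
      · exact ((hFc.continuousAt.pow 2).div (by fun_prop) (by positivity)).continuousWithinAt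
    · exact (continuous_const.mul (hfc.mul hFc)).continuousOn
  have hmono : MonotoneOn K (Set.Icc 0 r) := by
    have hKd : ∀ t ∈ Set.Ioo 0 r, HasDerivAt K (t ^ n * (f' t + μ * F t / t ^ n) ^ 2 + μ * t ^ n * (f t - N t * F t / (t ^ (n + 1) * φ (t ^ 2))) ^ 2) t := by
      intro t ht
      have ht0 : 0 < t := ht.1
      have hp := hpos t ht.1.le ht.2.le
      have := ((hId t).sub ((((hNd t).div (hφd t) hp.ne').mul (((hFd t).pow 2).div (hasDerivAt_pow (n + 1) t) (by positivity))).const_mul μ)).add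
        (((hf t).mul (hFd t)).const_mul (2 * μ))
      refine this.congr_deriv ?_
      have eN : ((n:ℝ) + 1) * φ (t ^ 2) = N t - 2 * t ^ 2 * φ' (t ^ 2) := by simp only [hN]; ring
      simp only [Pi.pow_apply, Pi.div_apply, Nat.cast_add, Nat.cast_one, Nat.add_sub_cancel]
      have eN' : ((n:ℝ) + 1) = (N t - 2 * t ^ 2 * φ' (t ^ 2)) / φ (t ^ 2) := by field_simp; linarith
      rw [eN']
      field_simp
      ring
    refine monotoneOn_of_deriv_nonneg (convex_Icc 0 r) hKc ?_ ?_
    · rw [interior_Icc]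
      exact fun t ht => (hKd t ht).differentiableAt.differentiableWithinAt
    · rw [interior_Icc]
      intro t ht
      rw [(hKd t ht).deriv]
      have := h.mupos
      have := ht.1
      positivity
  have := hmono (Set.left_mem_Icc.2 hr.le) (Set.right_mem_Icc.2 hr.le) hr.le
  have k0 : K 0 = 0 := by simp [hK, hI, hF]
  have k1 : K r = I r := by
    have : F r = 0 := h0
    simp [hK, this]
  rw [k0, k1] at this
  exact this

lemma radial_ineq {n : ℕ} {r μ : ℝ} {φ φ' φ'' : ℝ → ℝ} (h : IsProfile (n + 1) r μ φ φ' φ'')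
    (hr : 0 < r) (f f' : ℝ → ℝ) (hf : ∀ t, HasDerivAt f (f' t) t) (hf' : Continuous f') :
    0 ≤ (∫ t in (0:ℝ)..r, t ^ n * (f' t ^ 2 - μ * f t ^ 2)) + μ * ((n + 1) / r ^ (n + 1)) * (∫ t in (0:ℝ)..r, t ^ n * f t) ^ 2 := by
  have hfc : Continuous f := continuous_iff_continuousAt.2 fun t => (hf t).continuousAt
  set M := ∫ t in (0:ℝ)..r, t ^ n * f t with hM
  set c := ((n + 1) / r ^ (n + 1)) * M with hc
  have hii : ∀ {g : ℝ → ℝ}, Continuous g → IntervalIntegrable g volume 0 r := fun hg => hg.intervalIntegrable _ _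
  have hp : ∫ t in (0:ℝ)..r, t ^ n = r ^ (n + 1) / (n + 1) := by rw [integral_pow]; simp
  have hn : (0:ℝ) < n + 1 := by positivity
  have hz : ∫ t in (0:ℝ)..r, t ^ n * (f t - c) = 0 := by
    have e : ∀ t, t ^ n * (f t - c) = t ^ n * f t - c * t ^ n := fun t => by ring
    simp_rw [e]
    rw [intervalIntegral.integral_sub (hii (by fun_prop)) (hii (by fun_prop)), intervalIntegral.integral_const_mul, hp, hc]
    field_simp
    rw [← hM]; ring
  have := radial_zero h hr (fun t => f t - c) f' (fun t => (hf t).sub_const c) hf' hz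
  refine this.trans_eq ?_
  have e : ∀ t, t ^ n * (f' t ^ 2 - μ * (f t - c) ^ 2) = t ^ n * (f' t ^ 2 - μ * f t ^ 2) + ((2 * μ * c) * (t ^ n * f t) - μ * c ^ 2 * t ^ n) := fun t => by ring
  simp_rw [e]
  rw [intervalIntegral.integral_add (hii (by fun_prop)) (hii (by fun_prop)), intervalIntegral.integral_sub (hii (by fun_prop)) (hii (by fun_prop)),
    intervalIntegral.integral_const_mul, intervalIntegral.integral_const_mul, hp, ← hM, hc]
  field_simp
  ring

lemma integral_volumeIoiPow (n : ℕ) (f : ℝ → ℝ) :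
    ∫ x : Set.Ioi (0 : ℝ), f x ∂(Measure.volumeIoiPow n) = ∫ t in Set.Ioi (0:ℝ), t ^ n * f t := by
  simp only [Measure.volumeIoiPow, ENNReal.ofReal]
  rw [integral_withDensity_eq_integral_smul,
        integral_subtype_comap measurableSet_Ioi fun a ↦ Real.toNNReal (a ^ n) • f a,
        setIntegral_congr_fun measurableSet_Ioi fun x hx ↦ ?_]
  · rw [NNReal.smul_def, Real.coe_toNNReal _ (pow_nonneg (le_of_lt hx) _), smul_eq_mul]
  · exact (measurable_subtype_coe.pow_const _).real_toNNReal

lemma polar {n : ℕ} {r : ℝ} (hr : 0 < r) (g : Euc (n + 1) → ℝ) (hg : Continuous g) :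
    ∫ x in Metric.ball (0 : Euc (n + 1)) r, g x =
    ∫ θ, (∫ t in (0:ℝ)..r, t ^ n * g (t • (θ : Euc (n + 1)))) ∂((volume : Measure (Euc (n + 1))).toSphere) := by
  set G : Euc (n + 1) → ℝ := (Metric.ball (0 : Euc (n + 1)) r).indicator g with hG
  have hGi : Integrable G := (integrable_indicator_iff Metric.isOpen_ball.measurableSet).2 (intOn Metric.isBounded_ball hg)
  have hdim : Module.finrank ℝ (Euc (n + 1)) - 1 = n := by simp
  have hmp := (volume : Measure (Euc (n + 1))).measurePreserving_homeomorphUnitSphereProd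
  rw [hdim] at hmp
  set H : Metric.sphere (0 : Euc (n + 1)) 1 × Set.Ioi (0:ℝ) → ℝ := fun p => G ((p.2 : ℝ) • (p.1 : Euc (n + 1))) with hH
  have hcomp : ∀ x : ({0}ᶜ : Set (Euc (n + 1))), H (homeomorphUnitSphereProd (Euc (n + 1)) x) = G x := by
    intro x
    have hx : ‖(x : Euc (n + 1))‖ ≠ 0 := norm_ne_zero_iff.2 x.2
    simp only [hH]
    congr 1
    simp [smul_smul, hx]
  have hHi : Integrable H (((volume : Measure (Euc (n + 1))).toSphere).prod (Measure.volumeIoiPow n)) := by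
    have := hmp.integrable_comp_emb (g := H) (Homeomorph.measurableEmbedding _)
    rw [← this]
    have e : H ∘ homeomorphUnitSphereProd (Euc (n + 1)) = G ∘ Subtype.val := by
      ext x; exact hcomp x
    rw [e]
    exact (integrableOn_iff_comap_subtypeVal (measurableSet_singleton _).compl).1 hGi.integrableOn
  calc ∫ x in Metric.ball (0 : Euc (n + 1)) r, g x = ∫ x, G x := (integral_indicator Metric.isOpen_ball.measurableSet).symm
    _ = ∫ x : ({(0)}ᶜ : Set (Euc (n + 1))), G x.1 ∂((volume : Measure (Euc (n + 1))).comap (↑)) := by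
      rw [integral_subtype_comap (measurableSet_singleton _).compl fun x ↦ G x, restrict_compl_singleton]
    _ = ∫ p, H p ∂(((volume : Measure (Euc (n + 1))).toSphere).prod (Measure.volumeIoiPow n)) := by
      rw [← hmp.integral_comp (Homeomorph.measurableEmbedding _)]
      congr 1; ext x; exact (hcomp x).symm
    _ = ∫ θ, ∫ t, H (θ, t) ∂(Measure.volumeIoiPow n) ∂((volume : Measure (Euc (n + 1))).toSphere) :=
      integral_prod _ hHi
    _ = _ := by
      congr 1; ext θ
      rw [integral_volumeIoiPow n (fun t => G (t • (θ : Euc (n + 1)))), intervalIntegral.integral_of_le hr.le,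
        integral_Ioc_eq_integral_Ioo]
      have hθ : ‖(θ : Euc (n + 1))‖ = 1 := by simpa using θ.2
      rw [← integral_indicator measurableSet_Ioi, ← integral_indicator measurableSet_Ioo]
      congr 1; ext t
      by_cases ht : 0 < t
      · rw [Set.indicator_of_mem (show t ∈ Set.Ioi (0:ℝ) from ht)]
        by_cases ht2 : t < r
        · rw [Set.indicator_of_mem (show t ∈ Set.Ioo (0:ℝ) r from ⟨ht, ht2⟩), hG, Set.indicator_of_mem]
          rw [mem_ball_zero_iff, norm_smul, hθ, Real.norm_of_nonneg ht.le, mul_one]; exact ht2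
        · rw [Set.indicator_of_notMem (fun h : t ∈ Set.Ioo (0:ℝ) r => ht2 h.2), hG, Set.indicator_of_notMem, mul_zero]
          rw [mem_ball_zero_iff, norm_smul, hθ, Real.norm_of_nonneg ht.le, mul_one]; exact ht2
      · rw [Set.indicator_of_notMem (fun h : t ∈ Set.Ioi (0:ℝ) => ht h), Set.indicator_of_notMem (fun h : t ∈ Set.Ioo (0:ℝ) r => ht h.1)]

lemma polar_int {n : ℕ} {r : ℝ} (g : Euc (n + 1) → ℝ) (hg : Continuous g) :
    Continuous (fun θ : Metric.sphere (0 : Euc (n + 1)) 1 => ∫ t in (0:ℝ)..r, t ^ n * g (t • (θ : Euc (n + 1)))) := by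
  refine intervalIntegral.continuous_parametric_intervalIntegral_of_continuous' ?_ 0 r
  exact (continuous_snd.pow n).mul (hg.comp (continuous_snd.smul (continuous_subtype_val.comp continuous_fst)))

lemma radial_part {n : ℕ} {r μ : ℝ} {φ φ' φ'' : ℝ → ℝ} (h : IsProfile (n + 1) r μ φ φ' φ'')
    (hr : 0 < r) (k : Euc (n + 1) → ℝ) (hk : ContDiff ℝ (⊤ : ℕ∞) k) (hk0 : ∫ x in Metric.ball (0 : Euc (n + 1)) r, k x = 0)
    (δ : ℝ) (hosc : ∀ x ∈ Metric.ball (0 : Euc (n + 1)) r, ∀ y ∈ Metric.ball (0 : Euc (n + 1)) r, ‖x‖ = ‖y‖ → |k x - k y| ≤ δ) :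
    - (μ * (r ^ (n + 1) / (n + 1)) * ((volume : Measure (Euc (n + 1))).toSphere.real Set.univ) * δ ^ 2) ≤
     (∫ x in Metric.ball (0 : Euc (n + 1)) r, ‖fderiv ℝ k x‖ ^ 2) - μ * (∫ x in Metric.ball (0 : Euc (n + 1)) r, k x ^ 2) := by
  set σ := (volume : Measure (Euc (n + 1))).toSphere with hσ
  have hbd : Bornology.IsBounded (Metric.ball (0 : Euc (n + 1)) r) := Metric.isBounded_ball
  have hIntg : ∀ {g : Metric.sphere (0 : Euc (n + 1)) 1 → ℝ}, Continuous g → Integrable g σ := by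
    intro g hg
    exact hg.integrable_of_hasCompactSupport (HasCompactSupport.of_compactSpace g)
  have hfc : Continuous fun x => ‖fderiv ℝ k x‖ ^ 2 := (hk.continuous_fderiv (by simp)).norm.pow 2
  have hθ : ∀ θ : Metric.sphere (0 : Euc (n + 1)) 1, ‖(θ : Euc (n + 1))‖ = 1 := fun θ => by simpa using θ.2
  set m : Metric.sphere (0 : Euc (n + 1)) 1 → ℝ := fun θ => ∫ t in (0:ℝ)..r, t ^ n * k (t • (θ : Euc (n + 1))) with hm
  have hmc : Continuous m := polar_int k hk.continuous
  have hm0 : ∫ θ, m θ ∂σ = 0 := by rw [← hk0]; exact (polar hr k hk.continuous).symm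
  have hp : ∫ t in (0:ℝ)..r, t ^ n = r ^ (n + 1) / (n + 1) := by rw [integral_pow]; simp
  set c := r ^ (n + 1) / ((n : ℝ) + 1) with hc
  have hc0 : 0 < c := by positivity
  have hii : ∀ {g : ℝ → ℝ}, Continuous g → IntervalIntegrable g volume 0 r := fun hg => hg.intervalIntegrable _ _
  have hkθ : ∀ θ : Metric.sphere (0 : Euc (n + 1)) 1, Continuous fun t : ℝ => k (t • (θ : Euc (n + 1))) := fun θ =>
    hk.continuous.comp (continuous_id.smul continuous_const)
  have hosc2 : ∀ θ θ', m θ - m θ' ≤ c * δ := by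
    intro θ θ'
    have c1 := hkθ θ
    have c2 := hkθ θ'
    simp only [hm]
    rw [← intervalIntegral.integral_sub (hii (by fun_prop)) (hii (by fun_prop)), ← hp, ← intervalIntegral.integral_mul_const]
    refine intervalIntegral.integral_mono_on_of_le_Ioo hr.le (hii (by fun_prop)) (hii (by fun_prop)) ?_
    intro t ht
    have ht0 : 0 < t := ht.1
    have hb : ∀ θ : Metric.sphere (0 : Euc (n + 1)) 1, ‖t • (θ : Euc (n + 1))‖ = t := fun θ => by
      rw [norm_smul, hθ, Real.norm_of_nonneg ht.1.le, mul_one]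
    have := hosc (t • (θ : Euc (n + 1))) (by rw [mem_ball_zero_iff, hb]; exact ht.2) (t • (θ' : Euc (n + 1)))
      (by rw [mem_ball_zero_iff, hb]; exact ht.2) (by rw [hb, hb])
    have := (abs_le.1 this).2
    rw [← mul_sub]
    gcongr
  have hσ1 : 0 < σ.real Set.univ := by
    rw [hσ, Measure.toSphere_real_apply_univ]
    have : 0 < volume.real (Metric.ball (0 : Euc (n + 1)) 1) :=
      ENNReal.toReal_pos (Metric.measure_ball_pos volume _ (by positivity)).ne' measure_ball_lt_top.ne
    simp
    positivity
  have hm1 : ∀ θ, m θ ^ 2 ≤ (c * δ) ^ 2 := by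
    intro θ
    have a1 : m θ ≤ c * δ := by
      have := integral_mono (hIntg (continuous_const (y := m θ - c * δ))) (hIntg hmc) (fun θ' => show m θ - c * δ ≤ m θ' by linarith [hosc2 θ θ'])
      rw [hm0, integral_const, smul_eq_mul] at this
      nlinarith
    have a2 : - (c * δ) ≤ m θ := by
      have := integral_mono (hIntg hmc) (hIntg (continuous_const (y := m θ + c * δ))) (fun θ' => show m θ' ≤ m θ + c * δ by linarith [hosc2 θ' θ])
      rw [hm0, integral_const, smul_eq_mul] at this
      nlinarith
    exact sq_le_sq' a2 a1
  have i1 : IntegrableOn (fun x => ‖fderiv ℝ k x‖ ^ 2) (Metric.ball (0 : Euc (n + 1)) r) := intOn hbd hfc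
  have i2 : IntegrableOn (fun x => μ * k x ^ 2) (Metric.ball (0 : Euc (n + 1)) r) := intOn hbd (continuous_const.mul (hk.continuous.pow 2))
  have hgc : Continuous fun x => ‖fderiv ℝ k x‖ ^ 2 - μ * k x ^ 2 := hfc.sub (continuous_const.mul (hk.continuous.pow 2))
  rw [← integral_const_mul, ← integral_sub i1 i2, polar hr _ hgc]
  have key : ∀ θ : Metric.sphere (0 : Euc (n + 1)) 1, - (μ * c * δ ^ 2) ≤ ∫ t in (0:ℝ)..r, t ^ n * (‖fderiv ℝ k (t • (θ : Euc (n + 1)))‖ ^ 2 - μ * k (t • (θ : Euc (n + 1))) ^ 2) := by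
    intro θ
    have hd : ∀ t : ℝ, HasDerivAt (fun t : ℝ => k (t • (θ : Euc (n + 1)))) (fderiv ℝ k (t • (θ : Euc (n + 1))) θ) t := by
      intro t
      have h1 : HasDerivAt (fun t : ℝ => t • (θ : Euc (n + 1))) (θ : Euc (n + 1)) t := by
        simpa using (hasDerivAt_id t).smul_const (θ : Euc (n + 1))
      exact ((hk.differentiable (by simp) _).hasFDerivAt).comp_hasDerivAt t h1
    have hsc : Continuous fun t : ℝ => t • (θ : Euc (n + 1)) := continuous_id.smul continuous_const
    have hdc : Continuous fun t : ℝ => fderiv ℝ k (t • (θ : Euc (n + 1))) θ :=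
      ((hk.continuous_fderiv (by simp)).comp hsc).clm_apply continuous_const
    have h1 := radial_ineq h hr _ _ hd hdc
    have c1 := hkθ θ
    have h2 : ∫ t in (0:ℝ)..r, t ^ n * ((fderiv ℝ k (t • (θ : Euc (n + 1))) θ) ^ 2 - μ * k (t • (θ : Euc (n + 1))) ^ 2) ≤
       ∫ t in (0:ℝ)..r, t ^ n * (‖fderiv ℝ k (t • (θ : Euc (n + 1)))‖ ^ 2 - μ * k (t • (θ : Euc (n + 1))) ^ 2) := by
      refine intervalIntegral.integral_mono_on hr.le (hii (by fun_prop)) (hii ((continuous_id.pow n).mul (hgc.comp hsc))) ?_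
      intro t ht
      have ht0 : 0 ≤ t := ht.1
      have := (fderiv ℝ k (t • (θ : Euc (n + 1)))).le_opNorm θ
      rw [hθ, mul_one, Real.norm_eq_abs] at this
      gcongr 1
      refine sub_le_sub_right ?_ _
      rw [← sq_abs]
      gcongr
    have h3 := hm1 θ
    have hμ := h.mupos
    have h4 : μ * ((n + 1) / r ^ (n + 1)) * m θ ^ 2 ≤ μ * c * δ ^ 2 := by
      calc μ * ((n + 1) / r ^ (n + 1)) * m θ ^ 2 ≤ μ * ((n + 1) / r ^ (n + 1)) * (c * δ) ^ 2 := by gcongr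
        _ = _ := by rw [hc]; field_simp
    simp only [hm] at h4
    linarith
  have := integral_mono (hIntg (continuous_const (y := - (μ * c * δ ^ 2)))) (hIntg (polar_int (r := r) _ hgc)) key
  rw [integral_const, smul_eq_mul] at this
  refine le_trans (le_of_eq ?_) this
  ring

lemma ball_poincare {n : ℕ} {r μ : ℝ} {φ φ' φ'' : ℝ → ℝ} (h : IsProfile (n + 1) r μ φ φ' φ'')
    (hr : 0 < r) (f : Euc (n + 1) → ℝ) (hf : ContDiff ℝ (⊤ : ℕ∞) f) (hf0 : ∫ x in Metric.ball (0 : Euc (n + 1)) r, f x = 0) :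
    μ * (∫ x in Metric.ball (0 : Euc (n + 1)) r, f x ^ 2) ≤ ∫ x in Metric.ball (0 : Euc (n + 1)) r, ‖fderiv ℝ f x‖ ^ 2 := by
  set A := μ * (r ^ (n + 1) / (n + 1)) * ((volume : Measure (Euc (n + 1))).toSphere.real Set.univ) with hA
  have hs : ∀ δ > 0, - (A * δ ^ 2) ≤ (∫ x in Metric.ball (0 : Euc (n + 1)) r, ‖fderiv ℝ f x‖ ^ 2) - μ * (∫ x in Metric.ball (0 : Euc (n + 1)) r, f x ^ 2) := by
    intro δ hδ
    obtain ⟨k, hk, hk0, hkQ, hosc⟩ := exists_sym h hr f hf hf0 δ hδ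
    exact (radial_part h hr k hk hk0 δ hosc).trans hkQ
  have ht : Tendsto (fun δ : ℝ => - (A * δ ^ 2)) (nhdsWithin 0 (Set.Ioi 0)) (nhds 0) := by
    have : Continuous fun δ : ℝ => - (A * δ ^ 2) := by fun_prop
    have := this.continuousWithinAt (s := Set.Ioi 0) (x := 0)
    simpa [ContinuousWithinAt] using this
  have := le_of_tendsto ht (by filter_upwards [self_mem_nhdsWithin] with δ hδ using hs δ hδ)
  linarith

lemma le_neumann_ball {d : ℕ} (hd : 1 ≤ d) {r μ : ℝ} {φ φ' φ'' : ℝ → ℝ} (h : IsProfile d r μ φ φ' φ'')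
    (hr : 0 < r) (c : Euc d) : μ ≤ neumannEigenvalue 1 (Metric.ball c r) := by
  obtain ⟨n, rfl⟩ : ∃ n, d = n + 1 := ⟨d - 1, by omega⟩
  obtain ⟨v, hv⟩ : ∃ v : Euc (n + 1), v ≠ 0 := exists_ne 0
  have hv' : 0 < ‖v‖ := norm_pos_iff.2 hv
  have htr : ∀ g : Euc (n + 1) → ℝ, ∫ x in Metric.ball (0 : Euc (n + 1)) r, g (x + c) = ∫ x in Metric.ball c r, g x := by
    intro g
    have h1 := (measurePreserving_add_right (volume : Measure (Euc (n + 1))) c).setIntegral_preimage_emb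
      (Homeomorph.addRight c).measurableEmbedding g (Metric.ball c r)
    rw [← h1]
    congr 2
    ext x
    simp [dist_eq_norm]
  refine le_neumann Metric.isOpen_ball Metric.isBounded_ball c (c + (r / (2 * ‖v‖)) • v) (Metric.mem_ball_self hr) ?_ ?_ μ ?_
  · rw [Metric.mem_ball, dist_eq_norm, add_sub_cancel_left, norm_smul, Real.norm_of_nonneg (by positivity)]
    field_simp
    linarith
  · intro h0
    have : (r / (2 * ‖v‖)) • v = 0 := by simpa using h0
    rw [smul_eq_zero] at this
    rcases this with h1 | h1
    · have : 0 < r / (2 * ‖v‖) := by positivity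
      linarith
    · exact hv h1
  · intro u hu hu0
    have hu1 : ContDiff ℝ (⊤ : ℕ∞) (fun x => u (x + c)) := hu.comp (contDiff_id.add contDiff_const)
    have := ball_poincare h hr (fun x => u (x + c)) hu1 (by rw [htr u]; exact hu0)
    simp only [fderiv_comp_add_right] at this
    rw [htr (fun x => u x ^ 2), htr (fun x => ‖fderiv ℝ u x‖ ^ 2)] at this
    exact this

/-- The Weinberger density. -/
def HH (d : ℕ) (μ : ℝ) (ψ ψ' : ℝ → ℝ) (s : ℝ) : ℝ :=
  d * ψ s ^ 2 + 4 * s * ψ s * ψ' s + 4 * s ^ 2 * ψ' s ^ 2 - μ * s * ψ s ^ 2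

/-- A `C¹` extension of the radial profile. -/
structure IsExt (d : ℕ) (r μ : ℝ) (φ φ' ψ ψ' : ℝ → ℝ) : Prop where
  d1 : ∀ s, HasDerivAt ψ (ψ' s) s
  cont : Continuous ψ'
  pos : ∀ s, 0 ≤ s → 0 < ψ s
  eq0 : ∀ s, s ≤ r ^ 2 → ψ s = φ s
  eq1 : ∀ s, s ≤ r ^ 2 → ψ' s = φ' s
  inside : ∀ s, 0 ≤ s → s ≤ r ^ 2 → HH d μ ψ ψ' (r ^ 2) ≤ HH d μ ψ ψ' s
  outside : ∀ s, r ^ 2 ≤ s → HH d μ ψ ψ' s ≤ HH d μ ψ ψ' (r ^ 2)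

lemma HH_antitone {d : ℕ} (hd : 1 ≤ d) {r μ : ℝ} {φ φ' φ'' : ℝ → ℝ} (h : IsProfile d r μ φ φ' φ'') :
    AntitoneOn (HH d μ φ φ') (Set.Icc 0 (r ^ 2)) := by
  have hD : ∀ s, HasDerivAt (HH d μ φ φ') (-4 * (d - 1) * s * φ' s ^ 2 - 2 * μ * φ s * (φ s + 2 * s * φ' s)) s := by
    intro s
    have a := h.d1 s
    have b := h.d2 s
    have hid := hasDerivAt_id s
    have := ((((a.pow 2).const_mul (d:ℝ)).add (((hid.const_mul 4).mul a).mul b)).add (((hid.pow 2).const_mul 4).mul (b.pow 2))).sub ((hid.const_mul μ).mul (a.pow 2))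
    refine this.congr_deriv ?_
    simp only [Pi.mul_apply, id_eq, Pi.pow_apply, Nat.cast_ofNat]
    have o := h.ode s
    linear_combination (φ s + 2 * s * φ' s) * o
  have hd' : (1:ℝ) ≤ d := by exact_mod_cast hd
  refine antitoneOn_of_deriv_nonpos (convex_Icc _ _) (fun s _ => (hD s).continuousAt.continuousWithinAt)
    (fun s _ => (hD s).differentiableAt.differentiableWithinAt) ?_
  intro s hs
  rw [interior_Icc] at hs
  rw [(hD s).deriv]
  have h1 := (h.pos s hs.1.le hs.2.le).le
  have h2 := h.qnn s hs.1.le hs.2.le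
  have h3 := h.mupos.le
  have h4 : 0 ≤ (d - 1 : ℝ) * s * φ' s ^ 2 := by
    have := hs.1.le
    have : 0 ≤ (d - 1 : ℝ) := by linarith
    positivity
  have h5 : 0 ≤ μ * φ s * (φ s + 2 * s * φ' s) := by positivity
  nlinarith

lemma exists_ext {d : ℕ} (hd : 1 ≤ d) {r μ : ℝ} (hr : 0 < r) {φ φ' φ'' : ℝ → ℝ} (h : IsProfile d r μ φ φ' φ'') :
    ∃ ψ ψ', IsExt d r μ φ φ' ψ ψ' := by
  have hr2 : 0 < r ^ 2 := by positivity
  set c := r * φ (r ^ 2) with hc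
  have hφr : 0 < φ (r ^ 2) := h.pos _ hr2.le le_rfl
  have hc0 : 0 < c := by positivity
  have hq := h.qr
  have hφ' : φ' (r ^ 2) = - φ (r ^ 2) / (2 * r ^ 2) := by
    field_simp; linarith
  have hsr : √(r ^ 2) = r := Real.sqrt_sq hr.le
  set o : ℝ → ℝ := fun s => c / √s with ho
  set o' : ℝ → ℝ := fun s => - (c / √s) / (2 * s) with ho'
  have oe : o (r ^ 2) = φ (r ^ 2) := by simp only [ho, hsr, hc]; field_simp
  have oe' : o' (r ^ 2) = φ' (r ^ 2) := by
    rw [hφ', ← oe]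
  have hod : ∀ s, 0 < s → HasDerivAt o (o' s) s := by
    intro s hs
    have hs' : 0 < √s := Real.sqrt_pos.2 hs
    have := (hasDerivAt_const s c).div (Real.hasDerivAt_sqrt hs.ne') hs'.ne'
    refine this.congr_deriv ?_
    simp only [ho']
    have e : √s ^ 2 = s := Real.sq_sqrt hs.le
    rw [e]
    field_simp
    try ring
  set ψ : ℝ → ℝ := fun s => if s ≤ r ^ 2 then φ s else o s with hψ
  set ψ' : ℝ → ℝ := fun s => if s ≤ r ^ 2 then φ' s else o' s with hψ'
  have p1 : ∀ s, s ≤ r ^ 2 → ψ s = φ s := fun s hs => if_pos hs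
  have p1' : ∀ s, s ≤ r ^ 2 → ψ' s = φ' s := fun s hs => if_pos hs
  have p2 : ∀ s, r ^ 2 ≤ s → ψ s = o s := by
    intro s hs
    rcases hs.eq_or_lt with h1 | h1
    · rw [← h1, p1 _ le_rfl, oe]
    · exact if_neg (not_le.2 h1)
  have p2' : ∀ s, r ^ 2 ≤ s → ψ' s = o' s := by
    intro s hs
    rcases hs.eq_or_lt with h1 | h1
    · rw [← h1, p1' _ le_rfl, oe']
    · exact if_neg (not_le.2 h1)
  have hout : ∀ s, r ^ 2 ≤ s → HH d μ ψ ψ' s = (d - 1) * c ^ 2 / s - μ * c ^ 2 := by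
    intro s hs
    have hs0 : 0 < s := hr2.trans_le hs
    have hs' : 0 < √s := Real.sqrt_pos.2 hs0
    have e : √s ^ 2 = s := Real.sq_sqrt hs0.le
    unfold HH
    rw [p2 s hs, p2' s hs]
    have e1 : o' s = - o s / (2 * s) := rfl
    have e2 : o s ^ 2 = c ^ 2 / s := by simp only [ho, div_pow, e]
    rw [e1]
    have : (d:ℝ) * o s ^ 2 + 4 * s * o s * (-o s / (2 * s)) + 4 * s ^ 2 * (-o s / (2 * s)) ^ 2 - μ * s * o s ^ 2
      = (d - 1) * o s ^ 2 - μ * s * o s ^ 2 := by field_simp; ring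
    rw [this, e2]
    field_simp
  have hd' : (1:ℝ) ≤ d := by exact_mod_cast hd
  refine ⟨ψ, ψ', ?_, ?_, ?_, p1, p1', ?_, ?_⟩
  · intro s
    rcases lt_trichotomy s (r ^ 2) with hs | hs | hs
    · rw [p1' s hs.le]
      refine (h.d1 s).congr_of_eventuallyEq ?_
      filter_upwards [gt_mem_nhds hs] with t ht using p1 t (le_of_lt ht)
    · have a1 : HasDerivWithinAt ψ (ψ' s) (Set.Iic s) s := by
        rw [p1' s hs.le]
        exact (h.d1 s).hasDerivWithinAt.congr (fun t ht => p1 t (ht.trans hs.le)) (p1 s hs.le)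
      have a2 : HasDerivWithinAt ψ (ψ' s) (Set.Ici s) s := by
        rw [p2' s hs.ge]
        exact (hod s (by rw [hs]; exact hr2)).hasDerivWithinAt.congr (fun t ht => p2 t (hs.ge.trans ht)) (p2 s hs.ge)
      have := a1.union a2
      rw [Set.Iic_union_Ici] at this
      exact hasDerivWithinAt_univ.1 this
    · rw [p2' s hs.le]
      refine (hod s (hr2.trans hs)).congr_of_eventuallyEq ?_
      filter_upwards [lt_mem_nhds hs] with t ht using p2 t (le_of_lt ht)
  · have hcl : Continuous fun s : ℝ => - (c / √(max s (r ^ 2))) / (2 * max s (r ^ 2)) := by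
      have : ∀ s, 0 < max s (r ^ 2) := fun s => lt_max_of_lt_right hr2
      refine Continuous.div (Continuous.neg (Continuous.div continuous_const (by fun_prop) fun s => (Real.sqrt_pos.2 (this s)).ne')) (by fun_prop) fun s => by
        have := this s; positivity
    have e : ψ' = fun s => if s ≤ r ^ 2 then φ' s else - (c / √(max s (r ^ 2))) / (2 * max s (r ^ 2)) := by
      ext s
      simp only [hψ', ho']
      split_ifs with hs
      · rfl
      · rw [max_eq_left (not_le.1 hs).le]
    rw [e]
    refine Continuous.if_le h.smooth'.continuous hcl continuous_id continuous_const ?_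
    intro s hs
    have hs : s = r ^ 2 := hs
    rw [hs, max_self]
    exact oe'.symm
  · intro s hs
    rcases le_total s (r ^ 2) with h1 | h1
    · rw [p1 s h1]; exact h.pos s hs h1
    · rw [p2 s h1]
      exact div_pos hc0 (Real.sqrt_pos.2 (hr2.trans_le h1))
  · intro s h0 h1
    have := HH_antitone hd h ⟨h0, h1⟩ ⟨hr2.le, le_rfl⟩ h1
    unfold HH at this ⊢
    rw [p1 _ le_rfl, p1' _ le_rfl, p1 _ h1, p1' _ h1]
    exact this
  · intro s hs
    rw [hout s hs, hout _ le_rfl]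
    have : 0 ≤ ((d:ℝ) - 1) * c ^ 2 := mul_nonneg (by linarith) (sq_nonneg _)
    gcongr

lemma IsExt.contψ {d : ℕ} {r μ : ℝ} {φ φ' ψ ψ' : ℝ → ℝ} (h : IsExt d r μ φ φ' ψ ψ') : Continuous ψ :=
  continuous_iff_continuousAt.2 fun t => (h.d1 t).continuousAt

lemma IsExt.contHH {d : ℕ} {r μ : ℝ} {φ φ' ψ ψ' : ℝ → ℝ} (h : IsExt d r μ φ φ' ψ ψ') : Continuous (HH d μ ψ ψ') := by
  have := h.contψ
  have := h.cont
  unfold HH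
  fun_prop

lemma HH_ball {n : ℕ} {r μ : ℝ} (hr : 0 < r) {φ φ' φ'' ψ ψ' : ℝ → ℝ} (h : IsProfile (n + 1) r μ φ φ' φ'')
    (hE : IsExt (n + 1) r μ φ φ' ψ ψ') :
    ∫ x in Metric.ball (0 : Euc (n + 1)) r, HH (n + 1) μ ψ ψ' (‖x‖ ^ 2) = 0 := by
  have hcn : Continuous fun x : Euc (n + 1) => HH (n + 1) μ ψ ψ' (‖x‖ ^ 2) := hE.contHH.comp (continuous_norm.pow 2)
  rw [polar hr _ hcn]
  have key : ∫ t in (0:ℝ)..r, t ^ n * HH (n + 1) μ ψ ψ' (t ^ 2) = 0 := by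
    have hsqd : ∀ t : ℝ, HasDerivAt (fun t : ℝ => t ^ 2) (2 * t) t := fun t => by
      simpa using hasDerivAt_pow 2 t
    have hφd : ∀ t, HasDerivAt (fun t => φ (t ^ 2)) (φ' (t ^ 2) * (2 * t)) t := fun t =>
      (h.d1 (t ^ 2)).comp t (hsqd t)
    have hφ'd : ∀ t, HasDerivAt (fun t => φ' (t ^ 2)) (φ'' (t ^ 2) * (2 * t)) t := fun t =>
      (h.d2 (t ^ 2)).comp t (hsqd t)
    have hD : ∀ t ∈ Set.uIcc 0 r, HasDerivAt (fun t => t ^ (n + 1) * (φ (t ^ 2) * (φ (t ^ 2) + 2 * t ^ 2 * φ' (t ^ 2))))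
      (t ^ n * HH (n + 1) μ ψ ψ' (t ^ 2)) t := by
      intro t ht
      rw [Set.uIcc_of_le hr.le] at ht
      have hle : t ^ 2 ≤ r ^ 2 := by have := ht.1; have := ht.2; gcongr
      have := (hasDerivAt_pow (n + 1) t).mul ((hφd t).mul ((hφd t).add (((hsqd t).const_mul 2).mul (hφ'd t))))
      refine this.congr_deriv ?_
      unfold HH
      rw [hE.eq0 _ hle, hE.eq1 _ hle]
      simp only [Pi.mul_apply, Pi.add_apply, Nat.cast_add, Nat.cast_one, Nat.add_sub_cancel]
      have o := h.ode (t ^ 2)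
      push_cast at o
      linear_combination (t ^ (n + 2) * φ (t ^ 2)) * o
    rw [intervalIntegral.integral_eq_sub_of_hasDerivAt hD]
    · rw [h.qr]; simp
    · have := hE.contHH
      exact Continuous.intervalIntegrable (by fun_prop) _ _
  have e : ∀ θ : Metric.sphere (0 : Euc (n + 1)) 1, ∫ t in (0:ℝ)..r, t ^ n * HH (n + 1) μ ψ ψ' (‖t • (θ : Euc (n + 1))‖ ^ 2) = 0 := by
    intro θ
    rw [← key]
    congr 1; ext t
    have hθ : ‖(θ : Euc (n + 1))‖ = 1 := by simp
    rw [norm_smul, hθ, mul_one, Real.norm_eq_abs, sq_abs]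
  simp [e]

lemma HH_domain {n : ℕ} {r μ : ℝ} (hr : 0 < r) {φ φ' φ'' ψ ψ' : ℝ → ℝ} (h : IsProfile (n + 1) r μ φ φ' φ'')
    (hE : IsExt (n + 1) r μ φ φ' ψ ψ') (Ω : Set (Euc (n + 1))) (ho : IsOpen Ω) (hb : Bornology.IsBounded Ω)
    (c p : Euc (n + 1)) (hc : Metric.ball c r ⊆ Ω) :
    ∫ x in Ω, HH (n + 1) μ ψ ψ' (‖x - p‖ ^ 2) ≤ 0 := by
  set h0 := HH (n + 1) μ ψ ψ' (r ^ 2) with hh0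
  have hcont : Continuous fun x : Euc (n + 1) => HH (n + 1) μ ψ ψ' (‖x - p‖ ^ 2) := by
    have := hE.contHH
    fun_prop
  have hB : ∫ x in Metric.ball p r, HH (n + 1) μ ψ ψ' (‖x - p‖ ^ 2) = 0 := by
    rw [← HH_ball hr h hE]
    have h1 := (measurePreserving_add_right (volume : Measure (Euc (n + 1))) p).setIntegral_preimage_emb
      (Homeomorph.addRight p).measurableEmbedding (fun x => HH (n + 1) μ ψ ψ' (‖x - p‖ ^ 2)) (Metric.ball p r)
    rw [← h1]
    simp only [add_sub_cancel_right]
    congr 2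
    ext x
    simp [dist_eq_norm]
  have hmB : MeasurableSet (Metric.ball p r) := Metric.isOpen_ball.measurableSet
  have hvB : 0 < volume.real (Metric.ball p r) :=
    ENNReal.toReal_pos (Metric.measure_ball_pos volume _ hr).ne' measure_ball_lt_top.ne
  have iB : IntegrableOn (fun x => HH (n + 1) μ ψ ψ' (‖x - p‖ ^ 2)) (Metric.ball p r) := intOn Metric.isBounded_ball hcont
  have iΩ : IntegrableOn (fun x => HH (n + 1) μ ψ ψ' (‖x - p‖ ^ 2)) Ω := intOn hb hcont
  have ic : ∀ {S : Set (Euc (n + 1))}, Bornology.IsBounded S → IntegrableOn (fun _ => h0) S := fun hS => intOn hS continuous_const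
  have hin : ∀ x ∈ Metric.ball p r, h0 ≤ HH (n + 1) μ ψ ψ' (‖x - p‖ ^ 2) := by
    intro x hx
    rw [Metric.mem_ball, dist_eq_norm] at hx
    exact hE.inside _ (by positivity) (by gcongr)
  have hh : h0 ≤ 0 := by
    have := setIntegral_mono_on (ic Metric.isBounded_ball) iB hmB hin
    rw [hB, setIntegral_const, smul_eq_mul] at this
    by_contra! hcon
    have : 0 < volume.real (Metric.ball p r) * h0 := by positivity
    linarith
  have hvol : volume.real (Metric.ball p r) ≤ volume.real Ω := by
    have e : volume.real (Metric.ball p r) = volume.real (Metric.ball c r) := by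
      simp only [Measure.real, Measure.addHaar_ball_center]
    rw [e]
    exact measureReal_mono hc hb.measure_lt_top.ne
  have key : ∫ x in Ω, (HH (n + 1) μ ψ ψ' (‖x - p‖ ^ 2) - h0) ≤ ∫ x in Metric.ball p r, (HH (n + 1) μ ψ ψ' (‖x - p‖ ^ 2) - h0) := by
    rw [← integral_indicator ho.measurableSet, ← integral_indicator hmB]
    refine integral_mono ((integrable_indicator_iff ho.measurableSet).2 (iΩ.sub (ic hb)))
      ((integrable_indicator_iff hmB).2 (iB.sub (ic Metric.isBounded_ball))) ?_
    intro x
    by_cases hx : x ∈ Metric.ball p r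
    · rw [Set.indicator_of_mem hx]
      exact Set.indicator_le_self' (fun _ _ => sub_nonneg.2 (hin x hx)) x
    · rw [Set.indicator_of_notMem hx]
      refine Set.indicator_apply_le' (fun _ => ?_) fun _ => le_rfl
      rw [Metric.mem_ball, dist_eq_norm, not_lt] at hx
      exact sub_nonpos.2 (hE.outside _ (by gcongr))
  rw [integral_sub iΩ (ic hb), integral_sub iB (ic Metric.isBounded_ball), hB, setIntegral_const, setIntegral_const, smul_eq_mul, smul_eq_mul] at key
  nlinarith

lemma exists_center {d : ℕ} {Ω : Set (Euc d)} (ho : IsOpen Ω) (hb : Bornology.IsBounded Ω)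
    {ψ : ℝ → ℝ} (hψ : Continuous ψ) (hpos : ∀ s, 0 ≤ s → 0 < ψ s) :
    ∃ p : Euc d, ∀ e : Euc d, ∫ x in Ω, inner ℝ e (x - p) * ψ (‖x - p‖ ^ 2) = 0 := by
  obtain ⟨R, hR0, hR⟩ : ∃ R : ℝ, 0 < R ∧ Ω ⊆ Metric.closedBall 0 R := by
    obtain ⟨R, hR⟩ := hb.subset_closedBall 0
    exact ⟨max R 1, by positivity, hR.trans (Metric.closedBall_subset_closedBall (le_max_left _ _))⟩
  let Γ : ℝ → ℝ := fun s => ∫ t in (0 : ℝ)..s, ψ t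
  have hΓd : ∀ s, HasDerivAt Γ (ψ s) s := fun s =>
    (hψ.integral_hasStrictDerivAt 0 s).hasDerivAt
  have hΓc : Continuous Γ := continuous_iff_continuousAt.2 fun t => (hΓd t).continuousAt
  have hmono : MonotoneOn Γ (Set.Ici 0) := by
    apply monotoneOn_of_deriv_nonneg (convex_Ici 0) hΓc.continuousOn
    · exact fun x _ => (hΓd x).differentiableAt.differentiableWithinAt
    · intro x hx
      rw [interior_Ici] at hx
      rw [(hΓd x).deriv]
      exact (hpos x (le_of_lt hx)).le
  let E : Euc d → ℝ := fun p => ∫ x in Ω, Γ (‖x - p‖ ^ 2)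
  have hIntg : ∀ p : Euc d, IntegrableOn (fun x => Γ (‖x - p‖ ^ 2)) Ω := fun p =>
    intOn hb (by fun_prop)
  have hcst : ∀ C : ℝ, IntegrableOn (fun _ : Euc d => C) Ω := fun C => intOn hb continuous_const
  have hEc : ContinuousOn E (Metric.closedBall 0 (2 * R)) := by
    obtain ⟨C, hC⟩ := ((isCompact_closedBall (0 : Euc d) (2 * R)).prod
      (isCompact_closedBall (0 : Euc d) R)).exists_bound_of_continuousOn
      (f := fun z : Euc d × Euc d => Γ (‖z.2 - z.1‖ ^ 2)) (Continuous.continuousOn (by fun_prop))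
    refine MeasureTheory.continuousOn_of_dominated (bound := fun _ => C) ?_ ?_ (hcst C) ?_
    · intro p _
      exact (hIntg p).aestronglyMeasurable
    · intro p hp
      refine (ae_restrict_iff' ho.measurableSet).2 (Eventually.of_forall fun x hx => ?_)
      exact hC (p, x) ⟨hp, hR hx⟩
    · exact Eventually.of_forall fun x => Continuous.continuousOn (by fun_prop)
  obtain ⟨p, hpK, hpmin⟩ := (isCompact_closedBall (0 : Euc d) (2 * R)).exists_isMinOn
    ⟨0, by simp; positivity⟩ hEc
  have hglob : ∀ q, E p ≤ E q := by
    intro q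
    by_cases hq : q ∈ Metric.closedBall (0 : Euc d) (2 * R)
    · exact hpmin hq
    · have h0 : E p ≤ E 0 := hpmin (by simp; positivity)
      refine h0.trans ?_
      refine setIntegral_mono_on (hIntg 0) (hIntg q) ho.measurableSet ?_
      intro x hx
      have hx' := hR hx
      simp only [Metric.mem_closedBall, dist_zero_right, not_le] at hx' hq
      apply hmono (by simp) (by simp)
      have h1 : ‖q‖ - ‖x‖ ≤ ‖x - q‖ := by
        rw [norm_sub_rev]; exact norm_sub_norm_le q x
      rw [sub_zero]
      have : ‖x‖ ≤ ‖x - q‖ := by linarith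
      gcongr
  refine ⟨p, fun e => ?_⟩
  let F : ℝ → Euc d → ℝ := fun t x => Γ (‖x - (p + t • e)‖ ^ 2)
  let F' : ℝ → Euc d → ℝ := fun t x =>
    -2 * (inner ℝ e (x - (p + t • e)) * ψ (‖x - (p + t • e)‖ ^ 2))
  have hF'c : Continuous fun z : ℝ × Euc d => F' z.1 z.2 := by
    simp only [F']; fun_prop
  obtain ⟨C, hC⟩ := ((isCompact_closedBall (0 : ℝ) 1).prod
      (isCompact_closedBall (0 : Euc d) R)).exists_bound_of_continuousOn hF'c.continuousOn
  have key := hasDerivAt_integral_of_dominated_loc_of_deriv_le (μ := volume.restrict Ω) (F := F)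
    (F' := F') (x₀ := (0 : ℝ)) (s := Metric.closedBall 0 1) (bound := fun _ => C)
    (Metric.closedBall_mem_nhds 0 one_pos)
    (Eventually.of_forall fun t => (hIntg (p + t • e)).aestronglyMeasurable)
    (hIntg (p + (0 : ℝ) • e))
    (intOn hb (f := F' 0) (by simp only [F']; fun_prop)).aestronglyMeasurable
    ((ae_restrict_iff' ho.measurableSet).2 (Eventually.of_forall fun x hx t ht =>
      hC (t, x) ⟨ht, hR hx⟩))
    (hcst C)
    (Eventually.of_forall fun x t _ => by
      have h1 : HasDerivAt (fun t : ℝ => x - (p + t • e)) (-e) t := by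
        have := (((hasDerivAt_id t).smul_const e).const_add p).const_sub x
        simpa using this
      have h2 := h1.norm_sq
      have h3 := (hΓd (‖x - (p + t • e)‖ ^ 2)).comp t h2
      refine h3.congr_deriv ?_
      simp only [F', inner_neg_right, real_inner_comm]
      ring)
  have hmin : IsLocalMin (fun t : ℝ => ∫ x in Ω, F t x) 0 := by
    refine Eventually.of_forall fun t => ?_
    have := hglob (p + t • e)
    simpa [F, E] using this
  have h0 := hmin.hasDerivAt_eq_zero key.2
  simp only [F', zero_smul, add_zero, integral_const_mul] at h0
  linarith

lemma exists_approx {ψ ψ' : ℝ → ℝ} (h1 : ∀ s, HasDerivAt ψ (ψ' s) s) (hc : Continuous ψ')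
    (M : ℝ) (hM : 0 ≤ M) (n : ℕ) : ∃ P Q : ℝ → ℝ, ContDiff ℝ (⊤ : ℕ∞) P ∧
      (∀ s, HasDerivAt P (Q s) s) ∧ Continuous Q ∧ (∀ s ∈ Set.Icc 0 M, |Q s - ψ' s| ≤ 1 / ((n : ℝ) + 1)) ∧
      (∀ s ∈ Set.Icc 0 M, |P s - ψ s| ≤ M * (1 / ((n : ℝ) + 1))) := by
  obtain ⟨q, hq⟩ := exists_polynomial_near_of_continuousOn 0 M ψ' hc.continuousOn
    (1 / ((n : ℝ) + 1)) (by positivity)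
  let P : ℝ → ℝ := fun s => ψ 0 + ∫ t in (0 : ℝ)..s, q.eval t
  have hP : ∀ s, HasDerivAt P (q.eval s) s := fun s =>
    ((q.continuous.integral_hasStrictDerivAt 0 s).hasDerivAt).const_add _
  refine ⟨P, fun s => q.eval s, ?_, hP, q.continuous, fun s hs => (hq s hs).le, ?_⟩
  · rw [contDiff_infty_iff_deriv]
    refine ⟨fun s => (hP s).differentiableAt, ?_⟩
    have : deriv P = fun s => q.eval s := funext fun s => (hP s).deriv
    rw [this]
    simpa [Polynomial.aeval_def] using Polynomial.contDiff_aeval (𝕜 := ℝ) q (⊤ : ℕ∞)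
  · intro s hs
    have h := (convex_Icc (0 : ℝ) M).norm_image_sub_le_of_norm_hasDerivWithin_le
      (f := fun s => P s - ψ s) (f' := fun s => q.eval s - ψ' s) (C := 1 / ((n : ℝ) + 1))
      (x := 0) (y := s)
      (fun x _ => ((hP x).sub (h1 x)).hasDerivWithinAt)
      (fun x hx => (hq x hx).le) ⟨le_rfl, hM⟩ hs
    have hP0 : P 0 = ψ 0 := by simp [P]
    simp only [hP0, sub_self, sub_zero, Real.norm_eq_abs, abs_of_nonneg hs.1] at h
    refine h.trans ?_
    rw [mul_comm]
    gcongr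
    exact hs.2

lemma neumann_le_C1 {d : ℕ} {Ω : Set (Euc d)} (ho : IsOpen Ω) (hne : Ω.Nonempty)
    (hb : Bornology.IsBounded Ω) {ψ ψ' : ℝ → ℝ} (h1 : ∀ s, HasDerivAt ψ (ψ' s) s)
    (hc : Continuous ψ') (e p : Euc d)
    (hmean : ∫ x in Ω, inner ℝ e (x - p) * ψ (‖x - p‖ ^ 2) = 0)
    (hpos : 0 < ∫ x in Ω, (inner ℝ e (x - p) * ψ (‖x - p‖ ^ 2)) ^ 2) :
    neumannEigenvalue 1 Ω ≤ (∫ x in Ω, ‖gradw ψ ψ' e (x - p)‖ ^ 2) /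
      ∫ x in Ω, (inner ℝ e (x - p) * ψ (‖x - p‖ ^ 2)) ^ 2 := by
  obtain ⟨K, hK0, hK⟩ : ∃ K : ℝ, 0 < K ∧ ∀ x ∈ Ω, ‖x - p‖ ≤ K := by
    obtain ⟨R, hR⟩ := hb.subset_closedBall p
    refine ⟨max R 1, by positivity, fun x hx => ?_⟩
    have := hR hx
    rw [Metric.mem_closedBall, dist_eq_norm] at this
    exact this.trans (le_max_left _ _)
  have hψ : Continuous ψ := continuous_iff_continuousAt.2 fun t => (h1 t).continuousAt
  set M := K ^ 2 with hMdef
  have hM : 0 ≤ M := by positivity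
  have hs : ∀ x ∈ Ω, ‖x - p‖ ^ 2 ∈ Set.Icc 0 M := fun x hx =>
    ⟨by positivity, by have := hK x hx; rw [hMdef]; gcongr⟩
  obtain ⟨C1, hC1⟩ := (isCompact_Icc (a := (0:ℝ)) (b := M)).exists_bound_of_continuousOn hψ.continuousOn
  obtain ⟨C2, hC2⟩ := (isCompact_Icc (a := (0:ℝ)) (b := M)).exists_bound_of_continuousOn hc.continuousOn
  choose P Q hPs hPd hQc hQ hP using exists_approx h1 hc M hM
  have hinv : ∀ n : ℕ, 1 / ((n : ℝ) + 1) ≤ 1 := fun n => by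
    rw [div_le_one (by positivity)]; linarith [n.cast_nonneg (α := ℝ)]
  have hPb : ∀ n, ∀ s ∈ Set.Icc 0 M, |P n s| ≤ C1 + M := by
    intro n s h
    have a := hP n s h
    have b := hC1 s h
    rw [Real.norm_eq_abs] at b
    have c : M * (1 / ((n : ℝ) + 1)) ≤ M := mul_le_of_le_one_right hM (hinv n)
    have : |P n s| ≤ |P n s - ψ s| + |ψ s| := by
      simpa using abs_add_le (P n s - ψ s) (ψ s)
    linarith
  have hQb : ∀ n, ∀ s ∈ Set.Icc 0 M, |Q n s| ≤ C2 + 1 := by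
    intro n s h
    have a := hQ n s h
    have b := hC2 s h
    rw [Real.norm_eq_abs] at b
    have := hinv n
    have : |Q n s| ≤ |Q n s - ψ' s| + |ψ' s| := by
      simpa using abs_add_le (Q n s - ψ' s) (ψ' s)
    linarith
  have hPt : ∀ s ∈ Set.Icc 0 M, Tendsto (fun n => P n s) atTop (nhds (ψ s)) := by
    intro s h
    rw [tendsto_iff_norm_sub_tendsto_zero]
    refine squeeze_zero (fun _ => norm_nonneg _) (fun n => hP n s h) ?_
    simpa using (tendsto_one_div_add_atTop_nhds_zero_nat (𝕜 := ℝ)).const_mul M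
  have hQt : ∀ s ∈ Set.Icc 0 M, Tendsto (fun n => Q n s) atTop (nhds (ψ' s)) := by
    intro s h
    rw [tendsto_iff_norm_sub_tendsto_zero]
    exact squeeze_zero (fun _ => norm_nonneg _) (fun n => hQ n s h)
      (tendsto_one_div_add_atTop_nhds_zero_nat (𝕜 := ℝ))
  have hPc : ∀ n, Continuous (P n) := fun n => (hPs n).continuous
  let v : ℕ → Euc d → ℝ := fun n x => inner ℝ e (x - p) * P n (‖x - p‖ ^ 2)
  let w : Euc d → ℝ := fun x => inner ℝ e (x - p) * ψ (‖x - p‖ ^ 2)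
  have hvc : ∀ n, Continuous (v n) := fun n => by
    have := hPc n
    simp only [v]; fun_prop
  have hvs : ∀ n, ContDiff ℝ (⊤ : ℕ∞) (v n) := fun n => by
    have a : ContDiff ℝ (⊤ : ℕ∞) (fun x : Euc d => x - p) := contDiff_id.sub contDiff_const
    have b : ContDiff ℝ (⊤ : ℕ∞) (fun x : Euc d => (inner ℝ e (x - p) : ℝ)) :=
      contDiff_const.inner ℝ a
    exact b.mul ((contDiff_nsq (hPs n)).comp a)
  have hvf : ∀ n x, ‖fderiv ℝ (v n) x‖ = ‖gradw (P n) (Q n) e (x - p)‖ := by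
    intro n x
    have a := (hasFDerivAt_w (P n) (Q n) e (x - p) (hPd n _)).comp x
      ((hasFDerivAt_id x).sub_const p)
    have b : fderiv ℝ (v n) x = innerSL ℝ (gradw (P n) (Q n) e (x - p)) := by
      have a2 := a.fderiv
      simp only [ContinuousLinearMap.comp_id] at a2
      exact a2
    rw [b, innerSL_apply_norm]
  have hvb : ∀ n, ∀ x ∈ Ω, |v n x| ≤ ‖e‖ * K * (C1 + M) := by
    intro n x hx
    simp only [v, abs_mul]
    have a : |(inner ℝ e (x - p) : ℝ)| ≤ ‖e‖ * K :=
      (abs_real_inner_le_norm _ _).trans (by gcongr; exact hK x hx)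
    exact mul_le_mul a (hPb n _ (hs x hx)) (abs_nonneg _) (by positivity)
  have hvt : ∀ x ∈ Ω, Tendsto (fun n => v n x) atTop (nhds (w x)) := fun x hx =>
    (hPt _ (hs x hx)).const_mul _
  have hcst : ∀ C : ℝ, IntegrableOn (fun _ : Euc d => C) Ω := fun C => intOn hb continuous_const
  have T1 : Tendsto (fun n => ∫ x in Ω, v n x) atTop (nhds (∫ x in Ω, w x)) := by
    refine tendsto_integral_of_dominated_convergence (fun _ => ‖e‖ * K * (C1 + M))
      (fun n => (hvc n).aestronglyMeasurable) (hcst _) (fun n => ?_) ?_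
    · exact (ae_restrict_iff' ho.measurableSet).2 (Eventually.of_forall fun x hx => hvb n x hx)
    · exact (ae_restrict_iff' ho.measurableSet).2 (Eventually.of_forall fun x hx => hvt x hx)
  have T2 : Tendsto (fun n => ∫ x in Ω, v n x ^ 2) atTop (nhds (∫ x in Ω, w x ^ 2)) := by
    refine tendsto_integral_of_dominated_convergence (fun _ => (‖e‖ * K * (C1 + M)) ^ 2)
      (fun n => ((hvc n).pow 2).aestronglyMeasurable) (hcst _) (fun n => ?_) ?_
    · refine (ae_restrict_iff' ho.measurableSet).2 (Eventually.of_forall fun x hx => ?_)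
      rw [norm_pow]
      exact pow_le_pow_left₀ (norm_nonneg _) (hvb n x hx) 2
    · exact (ae_restrict_iff' ho.measurableSet).2 (Eventually.of_forall fun x hx => (hvt x hx).pow 2)
  have T3 : Tendsto (fun n => ∫ x in Ω, ‖gradw (P n) (Q n) e (x - p)‖ ^ 2) atTop
      (nhds (∫ x in Ω, ‖gradw ψ ψ' e (x - p)‖ ^ 2)) := by
    refine tendsto_integral_of_dominated_convergence
      (fun _ => ((C1 + M) * ‖e‖ + 2 * (‖e‖ * K) * (C2 + 1) * K) ^ 2)
      (fun n => ?_) (hcst _) (fun n => ?_) ?_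
    · have := hPc n
      have := hQc n
      refine Continuous.aestronglyMeasurable ?_
      unfold gradw
      fun_prop
    · refine (ae_restrict_iff' ho.measurableSet).2 (Eventually.of_forall fun x hx => ?_)
      rw [norm_pow, norm_norm]
      refine pow_le_pow_left₀ (norm_nonneg _) ?_ 2
      unfold gradw
      refine (norm_add_le _ _).trans ?_
      rw [norm_smul, norm_smul, Real.norm_eq_abs, Real.norm_eq_abs, abs_mul, abs_mul, abs_two]
      have a : |(inner ℝ e (x - p) : ℝ)| ≤ ‖e‖ * K :=
        (abs_real_inner_le_norm _ _).trans (by gcongr; exact hK x hx)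
      have b := hPb n _ (hs x hx)
      have c := hQb n _ (hs x hx)
      have k := hK x hx
      gcongr
      have c0 := (abs_nonneg _).trans c
      positivity
    · refine (ae_restrict_iff' ho.measurableSet).2 (Eventually.of_forall fun x hx => ?_)
      have a := hPt _ (hs x hx)
      have b := hQt _ (hs x hx)
      unfold gradw
      exact (((a.smul_const e).add (((b.const_mul (2 * inner ℝ e (x - p)))).smul_const (x - p))).norm).pow 2
  have hw0 : ∫ x in Ω, w x = 0 := hmean
  have hw2 : 0 < ∫ x in Ω, w x ^ 2 := hpos
  have T4 : Tendsto (fun n => (∫ x in Ω, v n x ^ 2) - (∫ x in Ω, v n x) ^ 2 / volume.real Ω) atTop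
      (nhds (∫ x in Ω, w x ^ 2)) := by
    have := T2.sub ((T1.pow 2).div_const (volume.real Ω))
    simpa [hw0] using this
  have T5 := T3.div T4 hw2.ne'
  refine ge_of_tendsto T5 ?_
  filter_upwards [T4.eventually (lt_mem_nhds hw2)] with n hn
  have := neumann_le ho hne hb (v n) (hvs n) hn
  simp only [hvf] at this
  exact this

lemma norm_gradw_sq {d : ℕ} (ψ ψ' : ℝ → ℝ) (e y : Euc d) (he : ‖e‖ = 1) :
    ‖gradw ψ ψ' e y‖ ^ 2 = ψ (‖y‖ ^ 2) ^ 2 + (inner ℝ e y) ^ 2 *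
      (4 * ψ (‖y‖ ^ 2) * ψ' (‖y‖ ^ 2) + 4 * ‖y‖ ^ 2 * ψ' (‖y‖ ^ 2) ^ 2) := by
  unfold gradw
  rw [norm_add_sq_real, norm_smul, norm_smul, he, mul_pow, mul_pow, inner_smul_left, inner_smul_right,
    Real.norm_eq_abs, Real.norm_eq_abs, sq_abs, sq_abs]
  simp only [conj_trivial]
  ring

lemma neumann_domain_le {n : ℕ} {r μ : ℝ} (hr : 0 < r) {φ φ' φ'' ψ ψ' : ℝ → ℝ}
    (h : IsProfile (n + 1) r μ φ φ' φ'')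
    (hE : IsExt (n + 1) r μ φ φ' ψ ψ') (Ω : Set (Euc (n + 1))) (ho : IsOpen Ω)
    (hb : Bornology.IsBounded Ω) (c : Euc (n + 1)) (hc : Metric.ball c r ⊆ Ω) :
    neumannEigenvalue 1 Ω ≤ μ := by
  have hcΩ : c ∈ Ω := hc (Metric.mem_ball_self hr)
  obtain ⟨p, hp⟩ := exists_center ho hb hE.contψ hE.pos
  have hψ := hE.contψ
  have hψ' := hE.cont
  let b := EuclideanSpace.basisFun (Fin (n + 1)) ℝ
  let G : Fin (n + 1) → Euc (n + 1) → ℝ := fun i x => ‖gradw ψ ψ' (b i) (x - p)‖ ^ 2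
  let W : Fin (n + 1) → Euc (n + 1) → ℝ := fun i x =>
    (inner ℝ (b i) (x - p) * ψ (‖x - p‖ ^ 2)) ^ 2
  have hGi : ∀ i, IntegrableOn (G i) Ω := fun i => intOn hb (by
    simp only [G]; unfold gradw; fun_prop)
  have hWc : ∀ i, Continuous (W i) := fun i => by simp only [W]; fun_prop
  have hWi : ∀ i, IntegrableOn (W i) Ω := fun i => intOn hb (hWc i)
  have hsum : ∑ i, ((∫ x in Ω, G i x) - μ * ∫ x in Ω, W i x) ≤ 0 := by
    have h0 := HH_domain hr h hE Ω ho hb c p hc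
    refine le_of_eq_of_le ?_ h0
    have : ∀ i, (∫ x in Ω, G i x) - μ * ∫ x in Ω, W i x = ∫ x in Ω, (G i x - μ * W i x) := by
      intro i
      rw [integral_sub (hGi i) ((hWi i).const_mul μ), integral_const_mul]
    simp only [this]
    have hi2 : ∀ i ∈ (Finset.univ : Finset (Fin (n + 1))),
        IntegrableOn (fun x => G i x - μ * W i x) Ω := fun i _ =>
      (hGi i).sub ((hWi i).const_mul μ)
    rw [← integral_finsetSum _ hi2]
    congr 1
    ext x
    have hs := b.sum_sq_inner_right (x - p)
    simp only [G, W, norm_gradw_sq ψ ψ' _ _ (b.norm_eq_one _), HH]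
    have : ∀ i, ψ (‖x - p‖ ^ 2) ^ 2 + (inner ℝ (b i) (x - p)) ^ 2 *
      (4 * ψ (‖x - p‖ ^ 2) * ψ' (‖x - p‖ ^ 2) + 4 * ‖x - p‖ ^ 2 * ψ' (‖x - p‖ ^ 2) ^ 2) -
      μ * (inner ℝ (b i) (x - p) * ψ (‖x - p‖ ^ 2)) ^ 2 = ψ (‖x - p‖ ^ 2) ^ 2 +
      (inner ℝ (b i) (x - p)) ^ 2 *
      (4 * ψ (‖x - p‖ ^ 2) * ψ' (‖x - p‖ ^ 2) + 4 * ‖x - p‖ ^ 2 * ψ' (‖x - p‖ ^ 2) ^ 2 -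
        μ * ψ (‖x - p‖ ^ 2) ^ 2) := fun i => by ring
    simp only [this]
    rw [Finset.sum_add_distrib, ← Finset.sum_mul, hs]
    simp
    ring
  obtain ⟨i, -, hi⟩ : ∃ i ∈ Finset.univ, (∫ x in Ω, G i x) - μ * ∫ x in Ω, W i x ≤ 0 :=
    Finset.exists_le_of_sum_le (g := fun _ => (0 : ℝ)) Finset.univ_nonempty (by simpa using hsum)
  have hW : 0 < ∫ x in Ω, W i x := by
    have hex : ∃ x ∈ Ω, inner ℝ (b i) (x - p) ≠ (0 : ℝ) := by
      by_contra! hall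
      have h1 := hall c hcΩ
      have hm : c + (r / 2) • b i ∈ Ω := by
        apply hc
        rw [Metric.mem_ball, dist_eq_norm, add_sub_cancel_left, norm_smul, b.norm_eq_one,
          Real.norm_eq_abs, abs_of_pos (by positivity)]
        linarith
      have h2 := hall _ hm
      rw [add_sub_right_comm, inner_add_right, h1, inner_smul_right, real_inner_self_eq_norm_sq,
        b.norm_eq_one] at h2
      linarith
    obtain ⟨x, hx, hxi⟩ := hex
    refine posint ho hb (hWc i) (fun x => sq_nonneg _) x hx ?_
    exact pow_ne_zero 2 (mul_ne_zero hxi (hE.pos _ (by positivity)).ne')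
  have key := neumann_le_C1 ho ⟨c, hcΩ⟩ hb hE.d1 hE.cont (b i) p (hp _) hW
  refine key.trans ?_
  rw [div_le_iff₀ hW]
  exact sub_nonpos.1 hi

/-- monotonicity of the first nontrivial Neumann eigenvalue holds when the
inner domain is a ball: if `B = ball c r ⊆ Ω` with `Ω` a nonempty bounded convex open set,
then `μ₁(B) ≥ μ₁(Ω)`. -/
theorem ball_inner_monotonicity
    (d : ℕ) (hd : 2 ≤ d) (c : Euc d) (r : ℝ) (hr : 0 < r)
    (Ω : Set (Euc d)) (hΩ : IsConvexDomain Ω) (hsub : Metric.ball c r ⊆ Ω) :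
    neumannEigenvalue 1 (Metric.ball c r) ≥ neumannEigenvalue 1 Ω := by
  obtain ⟨n, rfl⟩ : ∃ n, d = n + 1 := ⟨d - 1, by omega⟩
  obtain ⟨μ, φ, φ', φ'', h⟩ := exists_profile (n + 1) hd r hr
  obtain ⟨ψ, ψ', hE⟩ := exists_ext (by omega) hr h
  obtain ⟨-, ho, hb, -⟩ := hΩ
  exact (neumann_domain_le hr h hE Ω ho hb c hsub).trans (le_neumann_ball (by omega) h hr c)

end
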